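/- Let G=(V,E) be a supply graph and H=(V,D) a demand graph such that the multigraph G+H is planar and connected. Then the optimum value of the D-cycle packing LP (maximize the sum of f_C over all D-cycles C subject to: for every edge e of G+H, the sum of f_C over D-cycles C containing e is at most 1, and all f_C are nonnegative) is at most 32 times the maximum cardinality of a family of pairwise edge-disjoint D-cycles. In particular, the integrality gap of the D-cycle packing LP is at most 32 when G+H is planar. -/

import Mathlib

open scoped Classical

noncomputable section

/-- The edge set of a simple closed walk in the multigraph with endpoint map `ends`. -/
def IsCycle {V ε : Type} (ends : ε → Sym2 V) (C : Finset ε) : Prop :=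
  ∃ (n : ℕ) (v : Fin (n + 1) → V) (e : Fin (n + 1) → ε),
    Function.Injective v ∧ Function.Injective e ∧
    (∀ i, ends (e i) = s(v i, v (i + 1))) ∧
    C = Finset.image e Finset.univ

/-- The edge set of a simple (open) path. -/
def IsPath {V ε : Type} (ends : ε → Sym2 V) (P : Finset ε) : Prop :=
  ∃ (n : ℕ) (v : Fin (n + 1) → V) (e : Fin n → ε),
    Function.Injective v ∧ Function.Injective e ∧
    (∀ i : Fin n, ends (e i) = s(v i.castSucc, v i.succ)) ∧
    P = Finset.image e Finset.univ

/-- The cut `δ(U)`: edges with exactly one endpoint in `U`. -/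
def cutF {V ε : Type} [Fintype ε] (ends : ε → Sym2 V) (U : Set V) : Finset ε :=
  Finset.univ.filter (fun e => ∃ a b, ends e = s(a, b) ∧ a ∈ U ∧ b ∉ U)

/-- `U` is nonempty and induces a connected subgraph. -/
def ConnectedOn {V ε : Type} (ends : ε → Sym2 V) (U : Set V) : Prop :=
  U.Nonempty ∧ ∀ a ∈ U, ∀ b ∈ U,
    Relation.ReflTransGen (fun x y => x ∈ U ∧ y ∈ U ∧ ∃ e, ends e = s(x, y)) a b

/-- The multigraph is connected. -/
def MGConnected {V ε : Type} (ends : ε → Sym2 V) : Prop :=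
  ConnectedOn ends Set.univ

/-- `δ(U)` is a simple cut: both sides induce connected subgraphs. -/
def IsSimpleCut {V ε : Type} (ends : ε → Sym2 V) (U : Set V) : Prop :=
  ConnectedOn ends U ∧ ConnectedOn ends Uᶜ

/-- A `D`-cycle: a cycle containing exactly one demand edge. -/
def IsDCycle {V ε : Type} [DecidableEq ε] (ends : ε → Sym2 V) (Dem : Finset ε)
    (C : Finset ε) : Prop :=
  IsCycle ends C ∧ (C ∩ Dem).card = 1

/-- A `D`-cut: a simple cut containing exactly one demand edge. -/
def IsDCut {V ε : Type} [Fintype ε] [DecidableEq ε] (ends : ε → Sym2 V) (Dem : Finset ε)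
    (U : Set V) : Prop :=
  IsSimpleCut ends U ∧ (cutF ends U ∩ Dem).card = 1

/-- Planarity of a multigraph: there is a drawing in the plane with injective vertex
positions and arcs for the edges that are internally disjoint. -/
def IsPlanar {V ε : Type} (ends : ε → Sym2 V) : Prop :=
  ∃ (pos : V → ℝ × ℝ) (arc : ε → ℝ → ℝ × ℝ),
    Function.Injective pos ∧
    (∀ e, ContinuousOn (arc e) (Set.Icc 0 1)) ∧
    (∀ e a b, ends e = s(a, b) →
      (arc e 0 = pos a ∧ arc e 1 = pos b) ∨ (arc e 0 = pos b ∧ arc e 1 = pos a)) ∧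
    (∀ e, Set.InjOn (arc e) (Set.Ico 0 1)) ∧
    (∀ e f, e ≠ f → ∀ s ∈ Set.Ioo (0:ℝ) 1, ∀ t ∈ Set.Icc (0:ℝ) 1, arc e s ≠ arc f t) ∧
    (∀ e, ∀ s ∈ Set.Ioo (0:ℝ) 1, ∀ w, arc e s ≠ pos w)

/-- The mod 2 boundary of a chain of edges `g`, each joining `a g` to `b g`. -/
def bd {P γ : Type*} [Fintype γ] (a b : γ → P) (c : γ → ZMod 2) (p : P) : ZMod 2 :=
  ∑ g, ((if a g = p then c g else 0) + (if b g = p then c g else 0))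

/-- The graph with edges `l g — r g` is an algebraic dual of the graph with edges `a g — b g`:
the mod 2 cycles of the latter are the cuts of the former. -/
def IsDualPair {P γ Q : Type*} [Fintype γ] (a b : γ → P) (l r : γ → Q) : Prop :=
  ∀ c : γ → ZMod 2,
    (∀ p, bd a b c p = 0) ↔ ∃ S : Q → ZMod 2, ∀ g, c g = S (l g) + S (r g)

section Boundary

variable {P γ : Type*} [Fintype γ] (a b : γ → P)

theorem bd_add (c c' : γ → ZMod 2) (p : P) : bd a b (c + c') p = bd a b c p + bd a b c' p := by
  simp only [bd, ← Finset.sum_add_distrib]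
  refine Finset.sum_congr rfl fun g _ => ?_
  simp only [Pi.add_apply]
  split_ifs <;> ring

theorem bd_smul (t : ZMod 2) (c : γ → ZMod 2) (p : P) : bd a b (t • c) p = t * bd a b c p := by
  simp only [bd, Finset.mul_sum]
  refine Finset.sum_congr rfl fun g _ => ?_
  simp only [Pi.smul_apply, smul_eq_mul]
  split_ifs <;> ring

theorem bd_zero (p : P) : bd a b 0 p = 0 := by
  simp [bd]

theorem bd_sum {ι : Type*} (s : Finset ι) (c : ι → γ → ZMod 2) (p : P) :
    bd a b (∑ i ∈ s, c i) p = ∑ i ∈ s, bd a b (c i) p := by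
  induction s using Finset.induction_on with
  | empty => simp [bd_zero]
  | insert i s hi ih => rw [Finset.sum_insert hi, Finset.sum_insert hi, bd_add, ih]

theorem bd_single (g : γ) (p : P) :
    bd a b (Pi.single g 1) p = (if a g = p then 1 else 0) + (if b g = p then 1 else 0) := by
  unfold bd
  rw [Finset.sum_eq_single g]
  · simp
  · intro g' _ h
    simp [Pi.single_eq_of_ne h]
  · simp

/-- Summation by parts. -/
theorem sum_mul_bd (c : γ → ZMod 2) (X : Finset P) (S : P → ZMod 2) :
    ∑ p ∈ X, S p * bd a b c p =
      ∑ g, c g * ((if a g ∈ X then S (a g) else 0) + (if b g ∈ X then S (b g) else 0)) := by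
  simp only [bd, Finset.mul_sum]
  rw [Finset.sum_comm]
  refine Finset.sum_congr rfl fun g _ => ?_
  simp only [mul_add, Finset.sum_add_distrib, mul_ite, mul_zero, Finset.sum_ite_eq]
  split_ifs <;> ring

theorem sum_bd (c : γ → ZMod 2) (X : Finset P) :
    ∑ p ∈ X, bd a b c p =
      ∑ g, c g * ((if a g ∈ X then 1 else 0) + (if b g ∈ X then 1 else 0)) := by
  simpa using sum_mul_bd a b c X (fun _ => 1)

/-- A walk whose steps are edges satisfying `K` carries a chain joining its endpoints. -/
theorem exists_chain_of_reachable (K : γ → Prop) (R : P → P → Prop)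
    (hR : ∀ x y, R x y → ∃ g, K g ∧ ((a g = x ∧ b g = y) ∨ (a g = y ∧ b g = x)))
    {x y : P} (h : Relation.ReflTransGen R x y) :
    ∃ κ : γ → ZMod 2, (∀ g, κ g ≠ 0 → K g) ∧
      ∀ p, bd a b κ p = (if x = p then 1 else 0) + (if y = p then 1 else 0) := by
  induction h with
  | refl => exact ⟨0, by simp, fun p => by rw [bd_zero, CharTwo.add_self_eq_zero]⟩
  | @tail y z _ hyz ih =>
    obtain ⟨κ, hκ, hb⟩ := ih
    obtain ⟨g, hg, hends⟩ := hR _ _ hyz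
    refine ⟨κ + Pi.single g 1, ?_, ?_⟩
    · intro g' hg'
      by_cases h : g' = g
      · exact h ▸ hg
      · exact hκ g' (by simpa [Pi.single_eq_of_ne h] using hg')
    · intro p
      have h2 : ∀ t : ZMod 2, t + t = 0 := CharTwo.add_self_eq_zero
      rw [bd_add, hb, bd_single]
      rcases hends with ⟨rfl, rfl⟩ | ⟨rfl, rfl⟩
      · linear_combination h2 (if a g = p then 1 else 0)
      · linear_combination h2 (if b g = p then 1 else 0)

end Boundary

/-- Algebraic duality is inherited by minors: contracting the sets `X i` and keeping only the edges
`ρ e` amounts to identifying the faces on both sides of every deleted edge. -/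
theorem IsDualPair.minor {P γ Q I R : Type*} [Fintype γ] [Fintype I] [Fintype R]
    {a b : γ → P} {l r : γ → Q} (h : IsDualPair a b l r)
    (X : I → Finset P) (hX : ∀ i j p, p ∈ X i → p ∈ X j → i = j)
    (ρ : R → γ) (hρ : Function.Injective ρ) (a' b' : R → I)
    (ha : ∀ e, a (ρ e) ∈ X (a' e)) (hb : ∀ e, b (ρ e) ∈ X (b' e)) (hne : ∀ e, a' e ≠ b' e)
    (hconn : ∀ i, ∀ x ∈ X i, ∀ y ∈ X i, ∃ κ : γ → ZMod 2,
      (∀ g, κ g ≠ 0 → ∃ i, a g ∈ X i ∧ b g ∈ X i) ∧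
      ∀ p, bd a b κ p = (if x = p then 1 else 0) + (if y = p then 1 else 0))
    (rel : Q → Q → Prop)
    (hrel : ∀ q q', rel q q' ↔ ∃ g, g ∉ Set.range ρ ∧ ¬ (∃ i, a g ∈ X i ∧ b g ∈ X i) ∧
      l g = q ∧ r g = q') :
    IsDualPair a' b' (fun e => Quot.mk rel (l (ρ e))) (fun e => Quot.mk rel (r (ρ e))) := by
  have h2 : ∀ t : ZMod 2, t + t = 0 := CharTwo.add_self_eq_zero
  have hmem : ∀ e i, (a (ρ e) ∈ X i ↔ a' e = i) ∧ (b (ρ e) ∈ X i ↔ b' e = i) := fun e i =>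
    ⟨⟨fun hh => hX _ _ _ (ha e) hh, fun hh => hh ▸ ha e⟩,
      ⟨fun hh => hX _ _ _ (hb e) hh, fun hh => hh ▸ hb e⟩⟩
  -- the boundary at a contracted vertex
  have key : ∀ (ĉ : γ → ZMod 2) (i : I),
      (∀ g, g ∉ Set.range ρ → (¬ ∃ i, a g ∈ X i ∧ b g ∈ X i) → ĉ g = 0) →
      ∑ p ∈ X i, bd a b ĉ p = bd a' b' (fun e => ĉ (ρ e)) i := by
    intro ĉ i hz
    rw [sum_bd, bd]
    symm
    apply Fintype.sum_of_injective ρ hρ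
    · intro g hg
      by_cases hK : ∃ i, a g ∈ X i ∧ b g ∈ X i
      · obtain ⟨j, hj1, hj2⟩ := hK
        by_cases hij : j = i
        · subst hij; simp [hj1, hj2, h2]
        · rw [if_neg (fun hh => hij (hX _ _ _ hj1 hh)), if_neg (fun hh => hij (hX _ _ _ hj2 hh))]
          simp
      · simp [hz g hg hK]
    · intro e
      simp only [hmem, mul_add, mul_ite, mul_one, mul_zero]
  intro c
  constructor
  · intro hc
    set c0 : γ → ZMod 2 := fun g => ∑ e, if ρ e = g then c e else 0 with hc0
    have hc0ρ : ∀ e, c0 (ρ e) = c e := by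
      intro e
      simp only [hc0]
      rw [Finset.sum_eq_single e] <;> simp +contextual [hρ.eq_iff]
    have hc0' : ∀ g, g ∉ Set.range ρ → c0 g = 0 := by
      intro g hg
      refine Finset.sum_eq_zero fun e _ => if_neg fun hh => hg ⟨e, hh⟩
    set t := bd a b c0 with ht
    have htsum : ∀ i, ∑ p ∈ X i, t p = 0 := by
      intro i
      rw [key c0 i (fun g hg _ => hc0' g hg)]
      simp only [hc0ρ]
      exact hc i
    have ht0 : ∀ p, (∀ i, p ∉ X i) → t p = 0 := by
      intro p hp
      refine Finset.sum_eq_zero fun g _ => ?_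
      by_cases hg : g ∈ Set.range ρ
      · obtain ⟨e, rfl⟩ := hg
        rw [if_neg (fun hh : a (ρ e) = p => hp (a' e) (hh ▸ ha e)),
          if_neg (fun hh : b (ρ e) = p => hp (b' e) (hh ▸ hb e))]
        simp
      · simp [hc0' g hg]
    have hκ : ∀ i, ∃ κ : P → γ → ZMod 2, (∀ p g, κ p g ≠ 0 → ∃ i, a g ∈ X i ∧ b g ∈ X i) ∧
        ∀ q, ∑ p ∈ X i, t p * bd a b (κ p) q = if q ∈ X i then t q else 0 := by
      intro i
      by_cases hne : (X i).Nonempty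
      · obtain ⟨x, hx⟩ := hne
        have := fun p : X i => hconn i p.1 p.2 x hx
        choose κ hκ1 hκ2 using this
        refine ⟨fun p => if hp : p ∈ X i then κ ⟨p, hp⟩ else 0, ?_, ?_⟩
        · intro p g
          by_cases hp : p ∈ X i
          · simpa [hp] using hκ1 ⟨p, hp⟩ g
          · simp [hp]
        · intro q
          have : ∀ p ∈ X i, t p * bd a b (if hp : p ∈ X i then κ ⟨p, hp⟩ else 0) q =
              (if p = q then t p else 0) + (if x = q then 1 else 0) * t p := by
            intro p hp
            rw [dif_pos hp, hκ2 ⟨p, hp⟩ q]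
            split_ifs <;> ring
          rw [Finset.sum_congr rfl this, Finset.sum_add_distrib, ← Finset.mul_sum, htsum]
          simp
      · rw [Finset.not_nonempty_iff_eq_empty] at hne
        exact ⟨0, by simp, by simp [hne]⟩
    choose κ hκ1 hκ2 using hκ
    set ĉ : γ → ZMod 2 := c0 + ∑ i, ∑ p ∈ X i, t p • κ i p with hĉ
    have hĉ0 : ∀ g, (¬ ∃ i, a g ∈ X i ∧ b g ∈ X i) → ĉ g = c0 g := by
      intro g hg
      have : ∀ i p, κ i p g = 0 := fun i p => by
        by_contra hh
        exact hg (hκ1 i p g hh)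
      simp [hĉ, Finset.sum_apply, this]
    have hbd : ∀ q, bd a b ĉ q = 0 := by
      intro q
      rw [hĉ, bd_add, bd_sum]
      simp only [bd_sum, bd_smul, hκ2]
      by_cases hq : ∃ i, q ∈ X i
      · obtain ⟨i, hi⟩ := hq
        rw [Finset.sum_eq_single i]
        · rw [if_pos hi]; exact h2 _
        · intro j _ hj
          exact if_neg fun hh => hj (hX _ _ _ hh hi)
        · simp
      · push Not at hq
        rw [Finset.sum_eq_zero fun i _ => if_neg (hq i), add_zero]
        exact ht0 q hq
    obtain ⟨S, hS⟩ := (h ĉ).1 hbd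
    refine ⟨Quot.lift S ?_, ?_⟩
    · intro q q' hqq'
      obtain ⟨g, hg, hK, rfl, rfl⟩ := (hrel q q').1 hqq'
      have := hS g
      rw [hĉ0 g hK, hc0' g hg] at this
      exact CharTwo.add_eq_zero.1 this.symm
    · intro e
      have hK : ¬ ∃ i, a (ρ e) ∈ X i ∧ b (ρ e) ∈ X i := by
        rintro ⟨i, h1, h2⟩
        exact hne e (((hmem e i).1.1 h1).trans ((hmem e i).2.1 h2).symm)
      rw [← hc0ρ e, ← hĉ0 _ hK]
      exact hS _
  · rintro ⟨S, hS⟩ i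
    set ĉ : γ → ZMod 2 := fun g => S (Quot.mk rel (l g)) + S (Quot.mk rel (r g)) with hĉ
    have hbd : ∀ p, bd a b ĉ p = 0 :=
      (h ĉ).2 ⟨fun q => S (Quot.mk rel q), fun g => rfl⟩
    have := key ĉ i (fun g hg hK => by
      have : Quot.mk rel (l g) = Quot.mk rel (r g) :=
        Quot.sound ((hrel _ _).2 ⟨g, hg, hK, rfl, rfl⟩)
      simp only [hĉ, this]
      exact h2 _)
    rw [Finset.sum_eq_zero fun p _ => hbd p] at this
    have hcc : c = fun e => ĉ (ρ e) := funext hS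
    rw [hcc]
    exact this.symm

/-- Algebraic duality is symmetric. -/
theorem IsDualPair.symm {P γ Q : Type*} [Fintype γ] [Fintype P] [Fintype Q]
    {a b : γ → P} {l r : γ → Q} (h : IsDualPair a b l r) : IsDualPair l r a b := by
  intro c
  constructor
  · intro hc
    let δ : (P → ZMod 2) →ₗ[ZMod 2] (γ → ZMod 2) :=
      LinearMap.funLeft (ZMod 2) (ZMod 2) a + LinearMap.funLeft (ZMod 2) (ZMod 2) b
    have hδ : ∀ S g, δ S g = S (a g) + S (b g) := fun S g => rfl
    by_contra hne
    have hcr : c ∉ LinearMap.range δ := by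
      rintro ⟨S, rfl⟩
      exact hne ⟨S, hδ S⟩
    obtain ⟨φ, hφ, hle⟩ := Submodule.exists_le_ker_of_notMem hcr
    have hφ' : ∀ x, φ x = ∑ g, x g * φ (Pi.single g 1) := by
      intro x
      conv_lhs => rw [← Finset.univ_sum_single x, map_sum]
      refine Finset.sum_congr rfl fun g _ => ?_
      rw [← smul_eq_mul, ← map_smul, ← Pi.single_smul, smul_eq_mul, mul_one]
    obtain ⟨S, hS⟩ := (h fun g => φ (Pi.single g 1)).1 fun p => by
      have : φ (δ (Pi.single p 1)) = 0 := hle ⟨_, rfl⟩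
      rw [hφ'] at this
      rw [← this, bd]
      refine Finset.sum_congr rfl fun g _ => ?_
      rw [hδ, Pi.single_apply, Pi.single_apply]
      split_ifs <;> ring
    apply hφ
    rw [hφ']
    have := sum_mul_bd l r c Finset.univ S
    simp only [hc, mul_zero, Finset.sum_const_zero, Finset.mem_univ, if_true] at this
    rw [this]
    exact Finset.sum_congr rfl fun g _ => by rw [hS]
  · rintro ⟨S, hS⟩ q
    have hz := (h fun g => (if l g = q then 1 else 0) + (if r g = q then 1 else 0)).2
      ⟨fun q' => if q' = q then 1 else 0, fun g => rfl⟩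
    have := sum_mul_bd a b (fun g =>
      ((if l g = q then 1 else 0) + (if r g = q then 1 else 0) : ZMod 2)) Finset.univ S
    simp only [hz, mul_zero, Finset.sum_const_zero, Finset.mem_univ, if_true] at this
    rw [this, bd]
    refine Finset.sum_congr rfl fun g _ => ?_
    rw [hS]
    split_ifs <;> ring

/-- A nonzero mod 2 cycle in a simple graph has at least three edges. -/
theorem three_le_card_of_bd_eq_zero {T R : Type*} [Fintype R] (a b : R → T)
    (hne : ∀ e, a e ≠ b e) (hsimple : ∀ e e', s(a e, b e) = s(a e', b e') → e = e')
    (z : R → ZMod 2) (hz : ∀ p, bd a b z p = 0) (hz0 : z ≠ 0) :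
    3 ≤ (Finset.univ.filter fun e => z e ≠ 0).card := by
  have other : ∀ e p, z e ≠ 0 → (a e = p ∨ b e = p) →
      ∃ e', e' ≠ e ∧ z e' ≠ 0 ∧ (a e' = p ∨ b e' = p) := by
    intro e p he hp
    by_contra hcon
    push Not at hcon
    have := hz p
    rw [bd, Finset.sum_eq_single e] at this
    · rcases hp with hp | hp
      · rw [if_pos hp, if_neg (fun hh => hne e (hp.trans hh.symm))] at this
        exact he (by simpa using this)
      · rw [if_pos hp, if_neg (fun hh => hne e (hh.trans hp.symm))] at this
        exact he (by simpa using this)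
    · intro e' _ he'
      by_cases h0 : z e' = 0
      · simp [h0]
      · have := hcon e' he' h0
        simp [this.1, this.2]
    · simp
  obtain ⟨e, he⟩ : ∃ e, z e ≠ 0 := by
    by_contra hcon
    push Not at hcon
    exact hz0 (funext hcon)
  obtain ⟨e₁, h1, hz1, hp1⟩ := other e (a e) he (Or.inl rfl)
  obtain ⟨e₂, h2, hz2, hp2⟩ := other e (b e) he (Or.inr rfl)
  have h12 : e₁ ≠ e₂ := by
    rintro rfl
    apply h1
    apply hsimple
    have := hne e
    rw [Sym2.eq_iff]
    grind
  have hsub : ({e, e₁, e₂} : Finset R) ⊆ Finset.univ.filter fun e => z e ≠ 0 := by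
    intro x hx
    simp only [Finset.mem_insert, Finset.mem_singleton] at hx
    rcases hx with rfl | rfl | rfl <;> simpa
  have hcard : ({e, e₁, e₂} : Finset R).card = 3 :=
    Finset.card_eq_three.2 ⟨e, e₁, e₂, h1.symm, h2.symm, h12, rfl⟩
  exact hcard ▸ Finset.card_le_card hsub

/-- A simple graph with an algebraic dual is sparse. -/
theorem IsDualPair.card_edges_le {T R Q : Type*} [Fintype R] [Fintype T] [Fintype Q]
    {a b : R → T} {l r : R → Q} (h : IsDualPair a b l r)
    (hne : ∀ e, a e ≠ b e) (hsimple : ∀ e e', s(a e, b e) = s(a e', b e') → e = e') :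
    Fintype.card R ≤ 3 * Fintype.card T := by
  let dd : (R → ZMod 2) →ₗ[ZMod 2] (T → ZMod 2) :=
    { toFun := bd a b
      map_add' := fun c c' => funext fun p => bd_add a b c c' p
      map_smul' := fun t c => funext fun p => bd_smul a b t c p }
  let z : Q → R → ZMod 2 := fun q e => (if l e = q then 1 else 0) + (if r e = q then 1 else 0)
  let Q' : Finset Q := Finset.univ.filter fun q => z q ≠ 0
  have hzbd : ∀ q p, bd a b (z q) p = 0 := fun q =>
    (h (z q)).2 ⟨fun q' => if q' = q then 1 else 0, fun e => rfl⟩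
  have hker : LinearMap.ker dd ≤ Submodule.span (ZMod 2) (Q'.image z : Set (R → ZMod 2)) := by
    intro c hc
    obtain ⟨S, hS⟩ := (h c).1 fun p => congrFun (LinearMap.mem_ker.1 hc) p
    have hcz : c = ∑ q, S q • z q := by
      funext e
      rw [hS, Finset.sum_apply]
      simp [z, mul_add, Finset.sum_add_distrib]
    rw [hcz]
    refine Submodule.sum_mem _ fun q _ => Submodule.smul_mem _ _ ?_
    by_cases hq : z q = 0
    · rw [hq]; exact Submodule.zero_mem _
    · exact Submodule.subset_span (by
        rw [Finset.coe_image]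
        exact ⟨q, by simp [Q', hq], rfl⟩)
  have h1 : Module.finrank (ZMod 2) (LinearMap.ker dd) ≤ Q'.card :=
    (Submodule.finrank_mono hker).trans
      ((finrank_span_finset_le_card _).trans Finset.card_image_le)
  have h2 : Module.finrank (ZMod 2) (LinearMap.range dd) ≤ Fintype.card T := by
    simpa using Submodule.finrank_le (LinearMap.range dd)
  have h3 := LinearMap.finrank_range_add_finrank_ker dd
  have h4 : 3 * Q'.card ≤ 2 * Fintype.card R := by
    have hlow : ∑ q ∈ Q', 3 ≤ ∑ q ∈ Q', ∑ e, if z q e ≠ 0 then 1 else 0 := by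
      refine Finset.sum_le_sum fun q hq => ?_
      rw [← Finset.card_filter]
      exact three_le_card_of_bd_eq_zero a b hne hsimple (z q) (hzbd q)
        (Finset.mem_filter.1 hq).2
    have hup : ∑ q ∈ Q', (∑ e, if z q e ≠ 0 then 1 else 0) ≤ ∑ _e : R, 2 := by
      rw [Finset.sum_comm]
      refine Finset.sum_le_sum fun e _ => ?_
      rw [← Finset.card_filter]
      refine le_trans (Finset.card_le_card (t := {l e, r e}) ?_) Finset.card_le_two
      intro q hq
      have hq := (Finset.mem_filter.1 hq).2
      simp only [z] at hq
      by_contra hcon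
      simp only [Finset.mem_insert, Finset.mem_singleton, not_or] at hcon
      rw [if_neg (Ne.symm hcon.1), if_neg (Ne.symm hcon.2)] at hq
      simp at hq
    have := hlow.trans hup
    simp only [Finset.sum_const, Finset.card_univ, smul_eq_mul] at this
    omega
  have h5 : Module.finrank (ZMod 2) (R → ZMod 2) = Fintype.card R := by simp
  omega

/-- In a graph with an algebraic dual, every nonempty family of disjoint connected vertex sets has
a member adjacent to at most six others. -/
theorem IsDualPair.exists_few_neighbors {P γ Q ι : Type*} [Fintype γ] [Fintype Q]
    {a b : γ → P} {l r : γ → Q} (h : IsDualPair a b l r)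
    (X : ι → Finset P) (T : Finset ι) (hT : T.Nonempty)
    (hX : ∀ i ∈ T, ∀ j ∈ T, ∀ p, p ∈ X i → p ∈ X j → i = j)
    (hconn : ∀ i ∈ T, ∀ x ∈ X i, ∀ y ∈ X i, ∃ κ : γ → ZMod 2,
      (∀ g, κ g ≠ 0 → a g ∈ X i ∧ b g ∈ X i) ∧
      ∀ p, bd a b κ p = (if x = p then 1 else 0) + (if y = p then 1 else 0)) :
    ∃ i ∈ T, (T.filter fun j => i ≠ j ∧
      ∃ e, (a e ∈ X i ∧ b e ∈ X j) ∨ (a e ∈ X j ∧ b e ∈ X i)).card ≤ 6 := by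
  let H : SimpleGraph T :=
    { Adj := fun i j => i ≠ j ∧
        ∃ e, (a e ∈ X i ∧ b e ∈ X j) ∨ (a e ∈ X j ∧ b e ∈ X i)
      symm := ⟨fun i j hij => ⟨hij.1.symm, hij.2.imp fun e he => he.symm⟩⟩
      loopless := ⟨fun i hi => hi.1 rfl⟩ }
  have hrep : ∀ s : H.edgeSet, ∃ (e : γ) (i j : T), s.1 = s(i, j) ∧ i ≠ j ∧
      a e ∈ X i ∧ b e ∈ X j := by
    rintro ⟨s, hs⟩
    induction s using Sym2.ind with
    | _ i j =>
      obtain ⟨hij, e, he | he⟩ := (SimpleGraph.mem_edgeSet H).1 hs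
      · exact ⟨e, i, j, rfl, hij, he⟩
      · exact ⟨e, j, i, Sym2.eq_swap, hij.symm, he⟩
  choose ρ a' b' hs hne ha hb using hrep
  have huniq : ∀ (i j : T) p, p ∈ X i → p ∈ X j → i = j := fun i j p hi hj =>
    Subtype.ext (hX i i.2 j j.2 p hi hj)
  have hρ : Function.Injective ρ := by
    intro s s' hss
    have h1 := huniq _ _ _ (ha s) (hss ▸ ha s')
    have h2 := huniq _ _ _ (hb s) (hss ▸ hb s')
    exact Subtype.ext ((hs s).trans ((h1 ▸ h2 ▸ rfl : _ = _).trans (hs s').symm))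
  let rel : Q → Q → Prop := fun q q' => ∃ g, g ∉ Set.range ρ ∧
    ¬ (∃ i : T, a g ∈ X i ∧ b g ∈ X i) ∧ l g = q ∧ r g = q'
  have hH := h.minor (fun i : T => X i) huniq ρ hρ a' b' ha hb hne
    (fun i x hx y hy => by
      obtain ⟨κ, hκ, hb⟩ := hconn i i.2 x hx y hy
      exact ⟨κ, fun g hg => ⟨i, hκ g hg⟩, hb⟩) rel (fun _ _ => Iff.rfl)
  have : Finite (Quot rel) := Finite.of_surjective _ Quot.mk_surjective
  have : Fintype (Quot rel) := Fintype.ofFinite _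
  have hm := hH.card_edges_le hne (fun s s' hss => by
    apply Subtype.ext
    rw [hs s, hs s', hss])
  by_contra hcon
  push Not at hcon
  have hdeg : ∀ i : T, 7 ≤ H.degree i := by
    intro i
    refine (Nat.succ_le_of_lt (hcon i i.2)).trans (le_of_eq ?_)
    rw [← SimpleGraph.card_neighborFinset_eq_degree]
    symm
    refine Finset.card_bij (fun j _ => j.1) ?_ ?_ ?_
    · intro j hj
      obtain ⟨h1, h2⟩ := (SimpleGraph.mem_neighborFinset H i j).1 hj
      exact Finset.mem_filter.2 ⟨j.2, fun hh => h1 (Subtype.ext hh), h2⟩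
    · intro j _ j' _ hjj
      exact Subtype.ext hjj
    · intro j hj
      obtain ⟨h1, h2, h3⟩ := Finset.mem_filter.1 hj
      exact ⟨⟨j, h1⟩, (SimpleGraph.mem_neighborFinset H i _).2
        ⟨fun hh => h2 (congrArg Subtype.val hh), h3⟩, rfl⟩
  have hsum := SimpleGraph.sum_degrees_eq_twice_card_edges H
  have hge : ∑ _i : T, 7 ≤ ∑ i, H.degree i := Finset.sum_le_sum fun i _ => hdeg i
  have hcard : H.edgeFinset.card = Fintype.card H.edgeSet := by
    rw [SimpleGraph.edgeFinset_card]
  simp only [Finset.sum_const, Finset.card_univ, smul_eq_mul] at hge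
  have : Nonempty T := hT.to_subtype
  have hpos : 0 < Fintype.card T := Fintype.card_pos
  rw [hcard] at hsum
  omega

/-- A `k`-degenerate graph has an independent set with at least a `1 / (k + 1)` fraction of
the vertices. -/
theorem exists_independent {ι : Type*} (conf : ι → ι → Prop) (hsymm : ∀ i j, conf i j → conf j i)
    (k : ℕ) (S : Finset ι)
    (hdeg : ∀ T ⊆ S, T.Nonempty → ∃ i ∈ T, (T.filter fun j => i ≠ j ∧ conf i j).card ≤ k) :
    ∃ I ⊆ S, (∀ i ∈ I, ∀ j ∈ I, i ≠ j → ¬ conf i j) ∧ S.card ≤ (k + 1) * I.card := by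
  induction S using Finset.strongInduction with
  | H S ih =>
    rcases S.eq_empty_or_nonempty with rfl | hS
    · exact ⟨∅, by simp⟩
    · obtain ⟨i, hi, hk⟩ := hdeg S subset_rfl hS
      set B := S.filter fun j => i ≠ j ∧ conf i j with hB
      have hsub : (S.erase i) \ B ⊂ S :=
        (Finset.sdiff_subset).trans_ssubset (Finset.erase_ssubset hi)
      obtain ⟨I, hIS, hI, hcard⟩ := ih _ hsub fun T hT => hdeg T (hT.trans hsub.subset)
      have hiI : i ∉ I := fun hh => by simpa using hIS hh
      refine ⟨insert i I, Finset.insert_subset hi (hIS.trans hsub.subset), ?_, ?_⟩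
      · have hno : ∀ j ∈ I, ¬ conf i j := by
          intro j hj hc
          have := hIS hj
          simp only [hB, Finset.mem_sdiff, Finset.mem_erase, Finset.mem_filter] at this
          exact this.2 ⟨this.1.2, fun hh => this.1.1 hh.symm, hc⟩
        intro j hj j' hj' hjj
        rcases Finset.mem_insert.1 hj with h | h <;>
          rcases Finset.mem_insert.1 hj' with h' | h'
        · exact absurd (h.trans h'.symm) hjj
        · exact h ▸ hno _ h'
        · exact fun hc => hno _ h (hsymm _ _ (h' ▸ hc))
        · exact hI _ h _ h' hjj
      · rw [Finset.card_insert_of_notMem hiI]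
        have h1 := Finset.le_card_sdiff B (S.erase i)
        have h2 := Finset.card_erase_add_one hi
        have h3 : (k + 1) * (I.card + 1) = (k + 1) * I.card + (k + 1) := by ring
        omega

/-- The edge `e` has exactly one endpoint in `A`. -/
def Crosses {F ε : Type*} (l r : ε → F) (A : Finset F) (e : ε) : Prop :=
  ¬ (l e ∈ A ↔ r e ∈ A)

/-- The cut of `A` contains exactly one demand edge. -/
def IsDemandCut {F ε : Type*} (l r : ε → F) (Dem : Finset ε) (A : Finset F) : Prop :=
  ∃ d ∈ Dem, Crosses l r A d ∧ ∀ d' ∈ Dem, Crosses l r A d' → d' = d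

/-- A family of sets is laminar: any two members are nested or disjoint. -/
def IsLaminar {F ι : Type*} (A : ι → Finset F) : Prop :=
  ∀ i j, A i ⊆ A j ∨ A j ⊆ A i ∨ Disjoint (A i) (A j)

section Uncrossing

variable {F ε : Type*} (l r : ε → F)

theorem IsDemandCut.uncross {Dem : Finset ε} {A B : Finset F}
    (hA : IsDemandCut l r Dem A) (hB : IsDemandCut l r Dem B) :
    (IsDemandCut l r Dem (A ∩ B) ∧ IsDemandCut l r Dem (A ∪ B)) ∨
      (IsDemandCut l r Dem (A \ B) ∧ IsDemandCut l r Dem (B \ A)) := by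
  obtain ⟨x, hx, hxA, hA⟩ := hA
  obtain ⟨y, hy, hyB, hB⟩ := hB
  have main : ∀ (X Y : Finset F), (∀ d ∈ Dem, Crosses l r X d → d = x ∨ d = y) →
      (∀ d ∈ Dem, Crosses l r Y d → d = x ∨ d = y) →
      (x ≠ y → ((Crosses l r X x ∧ ¬ Crosses l r X y ∧ Crosses l r Y y ∧ ¬ Crosses l r Y x) ∨
        (Crosses l r X y ∧ ¬ Crosses l r X x ∧ Crosses l r Y x ∧ ¬ Crosses l r Y y))) →
      (x = y → Crosses l r X x ∧ Crosses l r Y x) →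
      IsDemandCut l r Dem X ∧ IsDemandCut l r Dem Y := by
    intro X Y h1 h2 h3 h4
    by_cases hxy : x = y
    · subst hxy
      exact ⟨⟨x, hx, (h4 rfl).1, fun d hd hc => by simpa using h1 d hd hc⟩,
        ⟨x, hx, (h4 rfl).2, fun d hd hc => by simpa using h2 d hd hc⟩⟩
    · rcases h3 hxy with h | h
      · exact ⟨⟨x, hx, h.1, fun d hd hc => (h1 d hd hc).resolve_right
            fun hh => h.2.1 (hh ▸ hc)⟩,
          ⟨y, hy, h.2.2.1, fun d hd hc => (h2 d hd hc).resolve_left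
            fun hh => h.2.2.2 (hh ▸ hc)⟩⟩
      · exact ⟨⟨y, hy, h.1, fun d hd hc => (h1 d hd hc).resolve_left
            fun hh => h.2.1 (hh ▸ hc)⟩,
          ⟨x, hx, h.2.2.1, fun d hd hc => (h2 d hd hc).resolve_right
            fun hh => h.2.2.2 (hh ▸ hc)⟩⟩
  have hall : ∀ d ∈ Dem, ¬ (d = x ∨ d = y) → ¬ Crosses l r A d ∧ ¬ Crosses l r B d :=
    fun d hd hne => ⟨fun hc => hne (Or.inl (hA d hd hc)), fun hc => hne (Or.inr (hB d hd hc))⟩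
  have hxB : x ≠ y → ¬ Crosses l r B x := fun hne hc => hne (hB x hx hc)
  have hyA : x ≠ y → ¬ Crosses l r A y := fun hne hc => hne (hA y hy hc).symm
  have hcases : (l x ∈ B ↔ l y ∈ A) ∧ x ≠ y ∨ ¬ (l x ∈ B ↔ l y ∈ A) ∧ x ≠ y ∨
      x = y ∧ (l x ∈ A ↔ l x ∈ B) ∨ x = y ∧ ¬ (l x ∈ A ↔ l x ∈ B) := by
    have h : ∀ p q r : Prop, (q ∧ ¬ p) ∨ (¬ q ∧ ¬ p) ∨ (p ∧ r) ∨ (p ∧ ¬ r) := by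
      intro p q r; tauto
    exact h _ _ _
  have hout : ∀ X : Finset F,
      (∀ d, ¬ Crosses l r A d → ¬ Crosses l r B d → ¬ Crosses l r X d) →
      ∀ d ∈ Dem, Crosses l r X d → d = x ∨ d = y := by
    intro X hX d hd hc
    by_contra hne
    exact hX d (hall d hd hne).1 (hall d hd hne).2 hc
  have hI : ∀ d, ¬ Crosses l r A d → ¬ Crosses l r B d → ¬ Crosses l r (A ∩ B) d := by
    intro d; simp only [Crosses, Finset.mem_inter]; grind
  have hU : ∀ d, ¬ Crosses l r A d → ¬ Crosses l r B d → ¬ Crosses l r (A ∪ B) d := by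
    intro d; simp only [Crosses, Finset.mem_union]; grind
  have hD : ∀ d, ¬ Crosses l r A d → ¬ Crosses l r B d → ¬ Crosses l r (A \ B) d := by
    intro d; simp only [Crosses, Finset.mem_sdiff]; grind
  have hD' : ∀ d, ¬ Crosses l r A d → ¬ Crosses l r B d → ¬ Crosses l r (B \ A) d := by
    intro d; simp only [Crosses, Finset.mem_sdiff]; grind
  rcases hcases with ⟨h, hne⟩ | ⟨h, hne⟩ | ⟨rfl, h⟩ | ⟨rfl, h⟩
  · right
    have h1 := hxB hne
    have h2 := hyA hne
    refine main _ _ (hout _ hD) (hout _ hD') (fun _ => ?_) (fun hh => absurd hh hne)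
    simp only [Crosses, Finset.mem_sdiff] at *
    clear main hout hI hU hD hD' hall hA hB hxB hyA
    grind
  · left
    have h1 := hxB hne
    have h2 := hyA hne
    refine main _ _ (hout _ hI) (hout _ hU) (fun _ => ?_) (fun hh => absurd hh hne)
    simp only [Crosses, Finset.mem_inter, Finset.mem_union] at *
    clear main hout hI hU hD hD' hall hA hB hxB hyA
    grind
  · left
    refine main _ _ (hout _ hI) (hout _ hU) (fun hh => absurd rfl hh) (fun _ => ?_)
    simp only [Crosses, Finset.mem_inter, Finset.mem_union] at *
    clear main hout hI hU hD hD' hall hA hB hxB hyA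
    grind
  · right
    refine main _ _ (hout _ hD) (hout _ hD') (fun hh => absurd rfl hh) (fun _ => ?_)
    simp only [Crosses, Finset.mem_sdiff] at *
    clear main hout hI hU hD hD' hall hA hB hxB hyA
    grind

theorem crosses_inter_add_union_le (A B : Finset F) (e : ε) :
    (if Crosses l r (A ∩ B) e then 1 else 0) + (if Crosses l r (A ∪ B) e then 1 else 0) ≤
      (if Crosses l r A e then 1 else 0) + (if Crosses l r B e then 1 else 0 : ℕ) := by
  simp only [Crosses, Finset.mem_inter, Finset.mem_union]
  by_cases h1 : l e ∈ A <;> by_cases h2 : r e ∈ A <;> by_cases h3 : l e ∈ B <;>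
    by_cases h4 : r e ∈ B <;> simp [h1, h2, h3, h4]

theorem crosses_sdiff_add_sdiff_le (A B : Finset F) (e : ε) :
    (if Crosses l r (A \ B) e then 1 else 0) + (if Crosses l r (B \ A) e then 1 else 0) ≤
      (if Crosses l r A e then 1 else 0) + (if Crosses l r B e then 1 else 0 : ℕ) := by
  simp only [Crosses, Finset.mem_sdiff]
  by_cases h1 : l e ∈ A <;> by_cases h2 : r e ∈ A <;> by_cases h3 : l e ∈ B <;>
    by_cases h4 : r e ∈ B <;> simp [h1, h2, h3, h4]

theorem sum_replace_two {ι α : Type*} [Fintype ι] (A : ι → α) {i j : ι} (hij : i ≠ j) (X Y : α)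
    (w : α → ℕ) :
    (∑ k, w (if k = i then X else if k = j then Y else A k)) + (w (A i) + w (A j)) =
      (∑ k, w (A k)) + (w X + w Y) := by
  have split : ∀ f : ι → ℕ, ∑ k, f k = f i + (f j + ∑ k ∈ (Finset.univ.erase i).erase j, f k) := by
    intro f
    rw [Finset.add_sum_erase _ _ (Finset.mem_erase.2 ⟨hij.symm, Finset.mem_univ j⟩),
      Finset.add_sum_erase _ _ (Finset.mem_univ i)]
  rw [split, split fun k => w (A k)]
  have : ∑ k ∈ (Finset.univ.erase i).erase j,
      w (if k = i then X else if k = j then Y else A k) =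
      ∑ k ∈ (Finset.univ.erase i).erase j, w (A k) := by
    refine Finset.sum_congr rfl fun k hk => ?_
    simp only [Finset.mem_erase] at hk
    rw [if_neg hk.2.1, if_neg hk.1]
  rw [this]
  simp only [if_true, if_neg hij.symm]
  ring

/-- A family of demand cuts can be uncrossed into a laminar one without increasing the load
on any edge. -/
theorem exists_laminar [Fintype F] {ι : Type*} [Fintype ι] (Dem : Finset ε) (M : ℕ)
    (A : ι → Finset F) (hA : ∀ i, IsDemandCut l r Dem (A i))
    (hcap : ∀ e, (Finset.univ.filter fun i => Crosses l r (A i) e).card ≤ M) :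
    ∃ B : ι → Finset F, IsLaminar B ∧ (∀ i, IsDemandCut l r Dem (B i)) ∧
      ∀ e, (Finset.univ.filter fun i => Crosses l r (B i) e).card ≤ M := by
  set φ : Finset F → ℕ := fun X => X.card * (Fintype.card F + 1 - X.card) with hφ
  obtain ⟨B, ⟨hB, hBcap⟩, hmin⟩ := Set.exists_min_image
    {B : ι → Finset F | (∀ i, IsDemandCut l r Dem (B i)) ∧
      ∀ e, (Finset.univ.filter fun i => Crosses l r (B i) e).card ≤ M}
    (fun B => ∑ i, φ (B i)) (Set.toFinite _) ⟨A, hA, hcap⟩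
  refine ⟨B, ?_, hB, hBcap⟩
  intro i j
  by_contra hcon
  push Not at hcon
  obtain ⟨hij, hji, hdis⟩ := hcon
  have hne : i ≠ j := by rintro rfl; exact hij subset_rfl
  have hreplace : ∀ X Y : Finset F, IsDemandCut l r Dem X → IsDemandCut l r Dem Y →
      (∀ e, (if Crosses l r X e then 1 else 0) + (if Crosses l r Y e then 1 else 0) ≤
        (if Crosses l r (B i) e then 1 else 0) + (if Crosses l r (B j) e then 1 else 0 : ℕ)) →
      φ (B i) + φ (B j) ≤ φ X + φ Y := by
    intro X Y hX hY hload
    have h1 := hmin (fun k => if k = i then X else if k = j then Y else B k) ⟨?_, ?_⟩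
    · have h2 := sum_replace_two B hne X Y φ
      omega
    · intro k
      dsimp only
      split_ifs
      exacts [hX, hY, hB k]
    · intro e
      refine le_trans ?_ (hBcap e)
      have h2 := sum_replace_two B hne X Y fun Z => if Crosses l r Z e then 1 else 0
      simp only [Finset.card_filter]
      have h3 := hload e
      omega
  have ha : 0 < (B i \ B j).card := Finset.card_pos.2 (Finset.sdiff_nonempty.2 hij)
  have hb : 0 < (B j \ B i).card := Finset.card_pos.2 (Finset.sdiff_nonempty.2 hji)
  have hc : 0 < (B i ∩ B j).card :=
    Finset.card_pos.2 (Finset.nonempty_iff_ne_empty.2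
      (Finset.disjoint_iff_inter_eq_empty.not.1 hdis))
  have e1 : (B i).card = (B i \ B j).card + (B i ∩ B j).card :=
    (Finset.card_sdiff_add_card_inter _ _).symm
  have e2 : (B j).card = (B j \ B i).card + (B i ∩ B j).card := by
    rw [Finset.inter_comm]; exact (Finset.card_sdiff_add_card_inter _ _).symm
  have e3 : (B i ∪ B j).card + (B i ∩ B j).card = (B i).card + (B j).card :=
    Finset.card_union_add_card_inter _ _
  have e4 : (B i ∪ B j).card ≤ Fintype.card F := Finset.card_le_univ _
  obtain ⟨o, ho⟩ := Nat.exists_eq_add_of_le e4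
  set a := (B i \ B j).card
  set b := (B j \ B i).card
  set c := (B i ∩ B j).card
  have e5 : (B i ∪ B j).card = a + b + c := by omega
  have s1 : Fintype.card F + 1 - (a + c) = b + o + 1 := by omega
  have s2 : Fintype.card F + 1 - (b + c) = a + o + 1 := by omega
  have s3 : Fintype.card F + 1 - c = a + b + o + 1 := by omega
  have s4 : Fintype.card F + 1 - (a + b + c) = o + 1 := by omega
  have s5 : Fintype.card F + 1 - a = b + c + o + 1 := by omega
  have s6 : Fintype.card F + 1 - b = a + c + o + 1 := by omega
  rcases (hB i).uncross l r (hB j) with ⟨h1, h2⟩ | ⟨h1, h2⟩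
  · have := hreplace _ _ h1 h2 (crosses_inter_add_union_le l r _ _)
    have hab := Nat.mul_pos ha hb
    simp only [hφ, e1, e2, e5, s1, s2, s4] at this
    rw [show (B i ∩ B j).card = c from rfl, s3] at this
    nlinarith
  · have := hreplace _ _ h1 h2 (crosses_sdiff_add_sdiff_le l r _ _)
    simp only [hφ, e1, e2, s1, s2] at this
    rw [show (B i \ B j).card = a from rfl, show (B j \ B i).card = b from rfl, s5, s6] at this
    nlinarith [Nat.mul_pos hc (Nat.succ_pos o)]

end Uncrossing

/-- In a laminar family there is a subfamily, smaller by a factor of at most `M`, which contains at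
most one set separating `x` from `y`, whenever at most `M` sets of the family do so. -/
theorem IsLaminar.exists_subfamily {F : Type*} {N : ℕ} {A : Fin N → Finset F} (hA : IsLaminar A)
    (M : ℕ) (hM : 0 < M) :
    ∃ S : Finset (Fin N), N ≤ M * S.card ∧ ∀ x y,
      (Finset.univ.filter fun i => x ∈ A i ∧ y ∉ A i).card ≤ M →
      ∀ i ∈ S, ∀ j ∈ S, x ∈ A i → y ∉ A i → x ∈ A j → y ∉ A j → i = j := by
  set above : Fin N → Fin N → Prop := fun k i => A i ⊂ A k ∨ (A k = A i ∧ k < i) with habove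
  set dep : Fin N → ℕ := fun i => (Finset.univ.filter fun k => above k i).card with hdep
  have htrans : ∀ i j k, above i j → above j k → above i k := by
    rintro i j k (h1 | ⟨h1, h1'⟩) (h2 | ⟨h2, h2'⟩)
    · exact Or.inl (h2.trans h1)
    · exact Or.inl (h2 ▸ h1)
    · exact Or.inl (h1 ▸ h2)
    · exact Or.inr ⟨h1.trans h2, h1'.trans h2'⟩
  have hirr : ∀ i, ¬ above i i := by
    rintro i (h | ⟨_, h⟩)
    · exact (ssubset_irrefl _ h)
    · exact lt_irrefl _ h
  have htri : ∀ x i j, x ∈ A i → x ∈ A j → i = j ∨ above i j ∨ above j i := by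
    intro x i j hi hj
    have hsub : A i ⊆ A j ∨ A j ⊆ A i := by
      rcases hA i j with h | h | h
      · exact Or.inl h
      · exact Or.inr h
      · exact absurd hj (Finset.disjoint_left.1 h hi)
    by_cases heq : A i = A j
    · rcases lt_trichotomy i j with h | h | h
      · exact Or.inr (Or.inl (Or.inr ⟨heq, h⟩))
      · exact Or.inl h
      · exact Or.inr (Or.inr (Or.inr ⟨heq.symm, h⟩))
    · rcases hsub with h | h
      · exact Or.inr (Or.inr (Or.inl (h.ssubset_of_ne heq)))
      · exact Or.inr (Or.inl (Or.inl (h.ssubset_of_ne (Ne.symm heq))))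
  have hsub : ∀ i j, above i j → A j ⊆ A i := by
    rintro i j (h | ⟨h, _⟩)
    · exact h.subset
    · exact h.symm.subset
  have key : ∀ x y, (Finset.univ.filter fun i => x ∈ A i ∧ y ∉ A i).card ≤ M →
      ∀ i j, above i j → x ∈ A i → y ∉ A i → x ∈ A j → y ∉ A j → dep i % M ≠ dep j % M := by
    intro x y hxy i j hij hxi hyi hxj hyj heq
    set D := Finset.univ.filter fun k => above k j ∧ ¬ above k i with hD
    have h1 : dep j = dep i + D.card := by
      rw [hdep]
      dsimp only
      rw [← Finset.card_union_of_disjoint]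
      · congr 1
        ext k
        simp only [hD, Finset.mem_filter, Finset.mem_union, Finset.mem_univ, true_and]
        constructor
        · intro h; by_cases hk : above k i
          · exact Or.inl hk
          · exact Or.inr ⟨h, hk⟩
        · rintro (h | h)
          · exact htrans _ _ _ h hij
          · exact h.1
      · rw [Finset.disjoint_left]
        intro k hk hk'
        exact (Finset.mem_filter.1 hk').2.2 (Finset.mem_filter.1 hk).2
    have h2 : 0 < D.card := Finset.card_pos.2 ⟨i, by simp [hD, hij, hirr i]⟩
    have h3 : D.card < M := by
      refine lt_of_lt_of_le (Finset.card_lt_card (Finset.ssubset_iff.2 ⟨j, ?_, ?_⟩)) hxy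
      · simp [hD, hirr j]
      · intro k hk
        rcases Finset.mem_insert.1 hk with rfl | hk
        · simp [hxj, hyj]
        · have hk := (Finset.mem_filter.1 hk).2
          have hxk := hsub _ _ hk.1 hxj
          have hyk : y ∉ A k := by
            rcases htri x k i hxk hxi with rfl | h | h
            · exact hyi
            · exact absurd h hk.2
            · exact fun hh => hyi (hsub _ _ h hh)
          simp [hxk, hyk]
    rw [h1] at heq
    have h4 : M ∣ D.card := by
      have := (Nat.modEq_iff_dvd' (Nat.le_add_right _ _)).1 heq
      simpa using this
    exact absurd (Nat.le_of_dvd h2 h4) (not_le.2 h3)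
  obtain ⟨θ, hθ⟩ : ∃ θ, N ≤ M * (Finset.univ.filter fun i => dep i % M = θ).card := by
    by_contra hcon
    push Not at hcon
    have h1 := Finset.card_eq_sum_card_fiberwise (s := (Finset.univ : Finset (Fin N)))
      (t := Finset.range M) (f := fun i => dep i % M)
      (fun i _ => by simpa using Nat.mod_lt _ hM)
    rw [Finset.card_univ, Fintype.card_fin] at h1
    have h2 : ∑ θ ∈ Finset.range M, M * (Finset.univ.filter fun i => dep i % M = θ).card <
        ∑ θ ∈ Finset.range M, N :=
      Finset.sum_lt_sum_of_nonempty ⟨0, by simpa using hM⟩ fun θ _ => hcon θ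
    rw [← Finset.mul_sum, ← h1] at h2
    simp at h2
  refine ⟨_, hθ, ?_⟩
  intro x y hxy i hi j hj hxi hyi hxj hyj
  have hi := (Finset.mem_filter.1 hi).2
  have hj := (Finset.mem_filter.1 hj).2
  rcases htri x i j hxi hxj with h | h | h
  · exact h
  · exact absurd (hi.trans hj.symm) (key x y hxy i j h hxi hyi hxj hyj)
  · exact absurd (hj.trans hi.symm) (key x y hxy j i h hxj hyj hxi hyi)

/-- Every demand cut contains a demand cut one of whose sides is connected. -/
theorem IsDemandCut.exists_connected {F ε : Type*} [Fintype ε] {l r : ε → F} {Dem : Finset ε}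
    {A : Finset F} (hA : IsDemandCut l r Dem A) :
    ∃ B ⊆ A, IsDemandCut l r Dem B ∧ (∀ e, Crosses l r B e → Crosses l r A e) ∧
      ∀ x ∈ B, ∀ y ∈ B, ∃ κ : ε → ZMod 2, (∀ g, κ g ≠ 0 → l g ∈ B ∧ r g ∈ B) ∧
        ∀ p, bd l r κ p = (if x = p then 1 else 0) + (if y = p then 1 else 0) := by
  obtain ⟨d, hd, hdA, huniq⟩ := hA
  obtain ⟨z, hzA, hz⟩ : ∃ z ∈ A, z = l d ∨ z = r d := by
    by_contra hcon
    push Not at hcon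
    exact hdA ⟨fun h => absurd rfl (hcon _ h).1, fun h => absurd rfl (hcon _ h).2⟩
  let R : F → F → Prop := fun x y =>
    x ∈ A ∧ y ∈ A ∧ ∃ g, (l g = x ∧ r g = y) ∨ (l g = y ∧ r g = x)
  have hRsymm : ∀ x y, R x y → R y x := fun x y ⟨h1, h2, g, hg⟩ => ⟨h2, h1, g, hg.symm⟩
  set B := A.filter fun p => Relation.ReflTransGen R z p with hB
  have hzB : z ∈ B := Finset.mem_filter.2 ⟨hzA, .refl⟩
  have hBA : B ⊆ A := Finset.filter_subset _ _
  have hclosed : ∀ e, l e ∈ A → r e ∈ A → (l e ∈ B ↔ r e ∈ B) := by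
    intro e h1 h2
    constructor
    · intro h
      exact Finset.mem_filter.2 ⟨h2, (Finset.mem_filter.1 h).2.tail ⟨h1, h2, e, Or.inl ⟨rfl, rfl⟩⟩⟩
    · intro h
      exact Finset.mem_filter.2 ⟨h1, (Finset.mem_filter.1 h).2.tail ⟨h2, h1, e, Or.inr ⟨rfl, rfl⟩⟩⟩
  have hcross : ∀ e, Crosses l r B e → Crosses l r A e := by
    intro e he hAe
    by_cases h1 : l e ∈ A
    · exact he (hclosed e h1 (hAe.1 h1))
    · exact he ⟨fun h => absurd (hBA h) h1, fun h => absurd (hAe.2 (hBA h)) h1⟩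
  refine ⟨B, hBA, ⟨d, hd, ?_, fun d' hd' h => huniq d' hd' (hcross d' h)⟩, hcross, ?_⟩
  · intro h
    rcases hz with rfl | rfl
    · exact hdA ⟨fun _ => hBA (h.1 hzB), fun _ => hzA⟩
    · exact hdA ⟨fun _ => hzA, fun _ => hBA (h.2 hzB)⟩
  · intro x hx y hy
    have hreach : ∀ w, Relation.ReflTransGen R z w →
        Relation.ReflTransGen (fun x y => x ∈ B ∧ y ∈ B ∧ R x y) z w := by
      intro w hw
      induction hw with
      | refl => exact .refl
      | @tail u v hu huv ih =>
        exact ih.tail ⟨Finset.mem_filter.2 ⟨huv.1, hu⟩,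
          Finset.mem_filter.2 ⟨huv.2.1, hu.tail huv⟩, huv⟩
    have hxy : Relation.ReflTransGen (fun x y => x ∈ B ∧ y ∈ B ∧ R x y) x y := by
      refine Relation.ReflTransGen.trans ?_ (hreach y (Finset.mem_filter.1 hy).2)
      have := (hreach x (Finset.mem_filter.1 hx).2).swap
      exact Relation.ReflTransGen.mono (fun u v (h : v ∈ B ∧ u ∈ B ∧ R v u) =>
        ⟨h.2.1, h.1, hRsymm _ _ h.2.2⟩) _ _ this
    exact exists_chain_of_reachable l r (fun g => l g ∈ B ∧ r g ∈ B) _ (by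
      rintro u v ⟨hu, hv, _, _, g, ⟨rfl, rfl⟩ | ⟨rfl, rfl⟩⟩
      · exact ⟨g, ⟨hu, hv⟩, Or.inl ⟨rfl, rfl⟩⟩
      · exact ⟨g, ⟨hv, hu⟩, Or.inr ⟨rfl, rfl⟩⟩) hxy

theorem Crosses.exists_side {F ε : Type*} {l r : ε → F} {A : Finset F} {e : ε}
    (h : Crosses l r A e) :
    ∃ x y, (x = l e ∧ y = r e ∨ x = r e ∧ y = l e) ∧ x ∈ A ∧ y ∉ A := by
  by_cases h1 : l e ∈ A
  · exact ⟨l e, r e, Or.inl ⟨rfl, rfl⟩, h1, fun h2 => h ⟨fun _ => h2, fun _ => h1⟩⟩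
  · refine ⟨r e, l e, Or.inr ⟨rfl, rfl⟩, ?_, h1⟩
    by_contra h2
    exact h ⟨fun h => absurd h h1, fun h => absurd h h2⟩

/-- From a laminar family of demand cuts in which every edge is crossed at most once from each
side, one can select a seventh and shrink its members to pairwise edge-disjoint demand cuts. -/
theorem exists_disjoint_cuts {V F ε ι : Type*} [Fintype V] [Fintype F] [Fintype ε]
    {a b : ε → V} {l r : ε → F} (h : IsDualPair a b l r) (Dem : Finset ε)
    {A : ι → Finset F} (hlam : IsLaminar A) (hA : ∀ i, IsDemandCut l r Dem (A i))
    (S : Finset ι)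
    (hS : ∀ e x y, (x = l e ∧ y = r e ∨ x = r e ∧ y = l e) →
      ∀ i ∈ S, ∀ j ∈ S, x ∈ A i → y ∉ A i → x ∈ A j → y ∉ A j → i = j) :
    ∃ (B : ι → Finset F) (I : Finset ι), (∀ i, IsDemandCut l r Dem (B i)) ∧
      (∀ i ∈ I, ∀ j ∈ I, i ≠ j → ∀ e, ¬ (Crosses l r (B i) e ∧ Crosses l r (B j) e)) ∧
      S.card ≤ 7 * I.card := by
  choose B hBA hB hcross hconn using fun i => (hA i).exists_connected
  obtain ⟨conf, hconf⟩ : ∃ conf : ι → ι → Prop,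
      ∀ i j, conf i j ↔ ∃ e, Crosses l r (B i) e ∧ Crosses l r (B j) e := ⟨_, fun _ _ => Iff.rfl⟩
  suffices hdeg : ∀ T ⊆ S, T.Nonempty → ∃ i ∈ T, (T.filter fun j => i ≠ j ∧ conf i j).card ≤ 6 by
    obtain ⟨I, hIS, hI, hcard⟩ := exists_independent conf
      (fun i j hij => (hconf j i).2 (((hconf i j).1 hij).imp fun e he => he.symm)) 6 S hdeg
    exact ⟨B, I, hB, fun i hi j hj hij e he => hI i hi j hj hij ((hconf i j).2 ⟨e, he⟩), hcard⟩
  rintro T hTS ⟨i₀, hi₀⟩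
  set U : ι → Finset ι := fun i => S.filter fun k => A i ⊂ A k with hU
  set T₀ := T.filter fun i => U i = U i₀ with hT₀
  have hmemU : ∀ i k, k ∈ U i ↔ k ∈ S ∧ A i ⊂ A k := fun i k => Finset.mem_filter
  have hsubset : ∀ i ∈ T₀, ∀ j ∈ T₀, A i ⊆ A j → i = j := by
    intro i hi j hj hij
    have hi := Finset.mem_filter.1 hi
    have hj := Finset.mem_filter.1 hj
    have heq : A i = A j := by
      by_contra hne
      have h1 : j ∈ U i := (hmemU _ _).2 ⟨hTS hj.1, hij.ssubset_of_ne hne⟩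
      rw [hi.2, ← hj.2] at h1
      exact ssubset_irrefl _ ((hmemU _ _).1 h1).2
    obtain ⟨d, -, hd, -⟩ := hA i
    obtain ⟨x, y, hxy, hx, hy⟩ := hd.exists_side
    exact hS d x y hxy i (hTS hi.1) j (hTS hj.1) hx hy (heq ▸ hx) (heq ▸ hy)
  obtain ⟨i, hi, hk⟩ := h.symm.exists_few_neighbors B T₀
    ⟨i₀, Finset.mem_filter.2 ⟨hi₀, rfl⟩⟩
    (by
      intro i hi j hj p hpi hpj
      rcases hlam i j with hh | hh | hh
      · exact hsubset i hi j hj hh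
      · exact (hsubset j hj i hi hh).symm
      · exact absurd (hBA j hpj) (Finset.disjoint_left.1 hh (hBA i hpi)))
    (fun i _ => hconn i)
  refine ⟨i, (Finset.mem_filter.1 hi).1, le_trans (Finset.card_le_card ?_) hk⟩
  intro j hj
  obtain ⟨hjT, hij, hc⟩ := Finset.mem_filter.1 hj
  obtain ⟨e, hei, hej⟩ := (hconf i j).1 hc
  have hi' := Finset.mem_filter.1 hi
  obtain ⟨x, y, hxy, hx, hy⟩ := hei.exists_side
  have hxA := hBA i hx
  have hyA : y ∉ A i := by
    have := hcross i e hei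
    rcases hxy with ⟨rfl, rfl⟩ | ⟨rfl, rfl⟩
    · exact fun hh => this ⟨fun _ => hh, fun _ => hxA⟩
    · exact fun hh => this ⟨fun _ => hxA, fun _ => hh⟩
  obtain ⟨u, v, huv, hu, hv⟩ := hej.exists_side
  have huA := hBA j hu
  have hvA : v ∉ A j := by
    have := hcross j e hej
    rcases huv with ⟨rfl, rfl⟩ | ⟨rfl, rfl⟩
    · exact fun hh => this ⟨fun _ => hh, fun _ => huA⟩
    · exact fun hh => this ⟨fun _ => huA, fun _ => hh⟩
  have hswap : u = y ∧ v = x := by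
    have hne : ¬ (u = x ∧ v = y) := by
      rintro ⟨rfl, rfl⟩
      exact hij (hS e u v hxy i (hTS hi'.1) j (hTS hjT) hxA hyA huA hvA)
    rcases hxy with ⟨rfl, rfl⟩ | ⟨rfl, rfl⟩ <;> rcases huv with ⟨rfl, rfl⟩ | ⟨rfl, rfl⟩
    · exact absurd ⟨rfl, rfl⟩ hne
    · exact ⟨rfl, rfl⟩
    · exact ⟨rfl, rfl⟩
    · exact absurd ⟨rfl, rfl⟩ hne
  obtain ⟨rfl, rfl⟩ := hswap
  have hsub : ∀ i j x y, i ∈ S → (x = l e ∧ y = r e ∨ x = r e ∧ y = l e) → x ∈ A i → y ∉ A i →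
      y ∈ A j → x ∉ A j → U i ⊆ U j := by
    intro i j x y hiS hxy hx hy hy' hx' k hk
    obtain ⟨hkS, hik⟩ := (hmemU _ _).1 hk
    have hxk := hik.subset hx
    have hyk : y ∈ A k := by
      by_contra hyk
      obtain rfl := hS e x y hxy i hiS k hkS hx hy hxk hyk
      exact ssubset_irrefl _ hik
    refine (hmemU _ _).2 ⟨hkS, ?_⟩
    rcases hlam j k with hh | hh | hh
    · exact hh.ssubset_of_ne fun heq => hx' (heq ▸ hxk)
    · exact absurd (hh hxk) hx'
    · exact absurd hyk (Finset.disjoint_left.1 hh hy')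
  have hUeq : U i = U j := subset_antisymm
    (hsub i j _ _ (hTS hi'.1) hxy hxA hyA huA hvA)
    (hsub j i _ _ (hTS hjT) huv huA hvA hxA hyA)
  refine Finset.mem_filter.2 ⟨Finset.mem_filter.2 ⟨hjT, hUeq ▸ hi'.2⟩, hij, e, ?_⟩
  rcases hxy with ⟨rfl, rfl⟩ | ⟨rfl, rfl⟩
  · exact Or.inl ⟨hx, hu⟩
  · exact Or.inr ⟨hu, hx⟩

theorem IsCycle.bd_eq_zero {V ε : Type} [Fintype ε] {ends : ε → Sym2 V} {a b : ε → V}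
    (hends : ∀ e, ends e = s(a e, b e)) {C : Finset ε} (hC : IsCycle ends C) (p : V) :
    bd a b (fun g => if g ∈ C then 1 else 0) p = 0 := by
  obtain ⟨n, v, e, hv, he, hve, rfl⟩ := hC
  have h1 : ∀ i, ((if a (e i) = p then 1 else 0) + (if b (e i) = p then 1 else 0) : ZMod 2) =
      (if v i = p then 1 else 0) + (if v (i + 1) = p then 1 else 0) := by
    intro i
    have := hve i
    rw [hends, Sym2.eq_iff] at this
    rcases this with ⟨h1, h2⟩ | ⟨h1, h2⟩
    · rw [h1, h2]
    · rw [h1, h2, add_comm]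
  have h2 : bd a b (fun g => if g ∈ Finset.image e Finset.univ then (1 : ZMod 2) else 0) p =
      ∑ g ∈ Finset.image e Finset.univ,
        ((if a g = p then 1 else 0) + (if b g = p then 1 else 0) : ZMod 2) := by
    rw [bd, ← Finset.sum_filter_add_sum_filter_not Finset.univ
      (fun g => g ∈ Finset.image e Finset.univ)]
    rw [Finset.sum_eq_zero (s := Finset.univ.filter fun g => g ∉ Finset.image e Finset.univ)
      (fun g hg => by rw [if_neg (Finset.mem_filter.1 hg).2]; simp), add_zero]
    refine Finset.sum_congr (by ext; simp) fun g hg => ?_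
    rw [if_pos hg]
  rw [h2, Finset.sum_image he.injOn, Finset.sum_congr rfl fun i _ => h1 i,
    Finset.sum_add_distrib]
  have h3 := Equiv.sum_comp (Equiv.addRight (1 : Fin (n + 1)))
    fun i => (if v i = p then (1 : ZMod 2) else 0)
  exact (congrArg _ h3).trans (CharTwo.add_self_eq_zero _)

/-- Every edge of an even edge set lies on a cycle contained in it. -/
theorem exists_isCycle_of_bd_eq_zero {V ε : Type} [Fintype V] [Fintype ε] {ends : ε → Sym2 V}
    {a b : ε → V} (hends : ∀ e, ends e = s(a e, b e)) {c : Finset ε}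
    (hc : ∀ p, bd a b (fun g => if g ∈ c then 1 else 0) p = 0) {d : ε} (hd : d ∈ c) :
    ∃ C ⊆ c, d ∈ C ∧ IsCycle ends C := by
  let G : SimpleGraph V :=
    { Adj := fun x y => x ≠ y ∧ ∃ g ∈ c, g ≠ d ∧ ends g = s(x, y)
      symm := ⟨fun x y h => ⟨h.1.symm,
        h.2.imp fun g hg => ⟨hg.1, hg.2.1, hg.2.2.trans Sym2.eq_swap⟩⟩⟩
      loopless := ⟨fun x h => h.1 rfl⟩ }
  have hreach : G.Reachable (a d) (b d) := by
    by_contra hcon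
    set U : Finset V := Finset.univ.filter fun p => G.Reachable (a d) p with hU
    have hmem : ∀ p, p ∈ U ↔ G.Reachable (a d) p := fun p => by simp [hU]
    have h1 := sum_bd a b (fun g => if g ∈ c then 1 else 0) U
    rw [Finset.sum_eq_zero fun p _ => hc p, Finset.sum_eq_single d, if_pos hd,
      if_pos ((hmem _).2 (SimpleGraph.Reachable.refl _)),
      if_neg (fun h => hcon ((hmem _).1 h))] at h1
    · simp at h1
    · intro g _ hgd
      by_cases hg : g ∈ c
      · have : a g ∈ U ↔ b g ∈ U := by
          by_cases hab : a g = b g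
          · rw [hab]
          · have hadj : G.Adj (a g) (b g) := ⟨hab, g, hg, hgd, hends g⟩
            rw [hmem, hmem]
            exact ⟨fun h => h.trans hadj.reachable, fun h => h.trans hadj.symm.reachable⟩
        simp only [this, CharTwo.add_self_eq_zero, mul_zero]
      · simp [hg]
    · simp
  obtain ⟨w, hw⟩ := hreach.exists_isPath
  have hstep : ∀ i : ℕ, ∃ g, i < w.length → g ∈ c ∧ g ≠ d ∧
      ends g = s(w.getVert i, w.getVert (i + 1)) := by
    intro i
    by_cases hi : i < w.length
    · obtain ⟨g, hg⟩ := (w.adj_getVert_succ hi).2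
      exact ⟨g, fun _ => hg⟩
    · exact ⟨d, fun h => absurd h hi⟩
  choose ed hed using hstep
  have hinj : ∀ i j, i ≤ w.length → j ≤ w.length → w.getVert i = w.getVert j → i = j :=
    fun i j hi hj h => hw.getVert_injOn hi hj h
  refine ⟨Finset.image (fun i : Fin (w.length + 1) => if (i : ℕ) < w.length then ed i else d)
    Finset.univ, ?_, ?_, w.length, fun i => w.getVert i, _, ?_, ?_, ?_, rfl⟩
  · intro g hg
    obtain ⟨i, -, rfl⟩ := Finset.mem_image.1 hg
    split_ifs with hi
    · exact (hed i hi).1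
    · exact hd
  · exact Finset.mem_image.2 ⟨Fin.last _, Finset.mem_univ _, by simp⟩
  · intro i j hij
    exact Fin.ext (hinj i j (Nat.lt_succ_iff.1 i.2) (Nat.lt_succ_iff.1 j.2) hij)
  · intro i j hij
    dsimp only at hij
    have hi2 := i.2
    have hj2 := j.2
    split_ifs at hij with hi hj hj
    · have h1 := (hed i hi).2.2
      rw [hij, (hed j hj).2.2, Sym2.eq_iff] at h1
      rcases h1 with ⟨h1, -⟩ | ⟨h1, h2⟩
      · exact Fin.ext (hinj _ _ hj.le hi.le h1).symm
      · have := hinj _ _ hj.le hi h1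
        have := hinj _ _ hj hi.le h2
        omega
    · exact absurd hij (hed i hi).2.1
    · exact absurd hij.symm (hed j hj).2.1
    · exact Fin.ext (by omega)
  · intro i
    dsimp only
    split_ifs with hi
    · rw [(hed i hi).2.2, Fin.val_add_one_of_lt (Fin.lt_def.2 (by simpa using hi))]
    · obtain rfl : i = Fin.last _ := Fin.ext (by have := i.2; simp; omega)
      rw [Fin.last_add_one]
      simp [hends, Sym2.eq_swap]

theorem zmod_two_eq_add_iff (P : Prop) [Decidable P] (s t : ZMod 2) :
    (if P then 1 else 0) = s + t ↔ (P ↔ ¬ (s = 1 ↔ t = 1)) := by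
  by_cases hP : P
  · simp only [hP, if_true, true_iff]; revert s t; decide
  · simp only [hP, if_false, false_iff]; revert s t; decide

/-- In a graph with an algebraic dual, every `D`-cycle is a demand cut of the dual. -/
theorem IsDCycle.exists_cut {V ε F : Type} [Fintype ε] [Fintype F] {ends : ε → Sym2 V}
    {a b : ε → V} {l r : ε → F} (hends : ∀ e, ends e = s(a e, b e)) (h : IsDualPair a b l r)
    {Dem C : Finset ε} (hC : IsDCycle ends Dem C) :
    ∃ A : Finset F, (∀ e, Crosses l r A e ↔ e ∈ C) ∧ IsDemandCut l r Dem A := by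
  obtain ⟨S, hS⟩ := (h _).1 (hC.1.bd_eq_zero hends)
  obtain ⟨d, hd⟩ := Finset.card_eq_one.1 hC.2
  have hcross : ∀ e, Crosses l r (Finset.univ.filter fun q => S q = 1) e ↔ e ∈ C := by
    intro e
    rw [(zmod_two_eq_add_iff _ _ _).1 (hS e)]
    simp [Crosses]
  have hd' : d ∈ C ∩ Dem := hd ▸ Finset.mem_singleton_self d
  refine ⟨_, hcross, d, (Finset.mem_inter.1 hd').2, (hcross d).2 (Finset.mem_inter.1 hd').1, ?_⟩
  intro d' hd' hc
  have : d' ∈ C ∩ Dem := Finset.mem_inter.2 ⟨(hcross d').1 hc, hd'⟩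
  rwa [hd, Finset.mem_singleton] at this

/-- In a graph with an algebraic dual, every demand cut of the dual contains a `D`-cycle. -/
theorem IsDemandCut.exists_isDCycle {V ε F : Type} [Fintype V] [Fintype ε]
    {ends : ε → Sym2 V} {a b : ε → V} {l r : ε → F} (hends : ∀ e, ends e = s(a e, b e))
    (h : IsDualPair a b l r) {Dem : Finset ε} {A : Finset F} (hA : IsDemandCut l r Dem A) :
    ∃ C : Finset ε, IsDCycle ends Dem C ∧ ∀ e ∈ C, Crosses l r A e := by
  obtain ⟨d, hd, hdA, huniq⟩ := hA
  set c : Finset ε := Finset.univ.filter fun e => Crosses l r A e with hc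
  have hmem : ∀ e, e ∈ c ↔ Crosses l r A e := fun e => by simp [hc]
  have hbd : ∀ p, bd a b (fun g => if g ∈ c then 1 else 0) p = 0 := by
    refine (h _).2 ⟨fun q => if q ∈ A then 1 else 0, fun g => ?_⟩
    rw [zmod_two_eq_add_iff, hmem, Crosses]
    simp
  obtain ⟨C, hCc, hdC, hC⟩ := exists_isCycle_of_bd_eq_zero hends hbd ((hmem d).2 hdA)
  refine ⟨C, ⟨hC, Finset.card_eq_one.2 ⟨d, ?_⟩⟩, fun e he => (hmem e).1 (hCc he)⟩
  ext e
  simp only [Finset.mem_inter, Finset.mem_singleton]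
  constructor
  · rintro ⟨h1, h2⟩
    exact huniq e h2 ((hmem e).1 (hCc h1))
  · rintro rfl
    exact ⟨hdC, hd⟩

/-- In a graph with an algebraic dual, the edge-disjoint packing of `D`-cycles is within a
constant factor of the fractional one. -/
theorem IsDualPair.exists_packing {V ε F : Type} [Fintype V] [Fintype ε] [Fintype F]
    {ends : ε → Sym2 V} {a b : ε → V} {l r : ε → F} (hends : ∀ e, ends e = s(a e, b e))
    (h : IsDualPair a b l r) (Dem : Finset ε) (f : Finset ε → ℝ) (hf0 : ∀ C, 0 ≤ f C)
    (hfcap : ∀ e : ε,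
      ∑ C ∈ Finset.univ.filter (fun C : Finset ε => IsDCycle ends Dem C ∧ e ∈ C), f C ≤ 1) :
    ∃ 𝓕 : Finset (Finset ε),
      (∀ C ∈ 𝓕, IsDCycle ends Dem C) ∧
      (∀ C₁ ∈ 𝓕, ∀ C₂ ∈ 𝓕, C₁ ≠ C₂ → Disjoint C₁ C₂) ∧
      ∑ C ∈ Finset.univ.filter (fun C : Finset ε => IsDCycle ends Dem C), f C
        ≤ 14 * (𝓕.card : ℝ) := by
  set D := Finset.univ.filter fun C : Finset ε => IsDCycle ends Dem C with hD
  have hmemD : ∀ C : D, IsDCycle ends Dem C.1 := fun C => (Finset.mem_filter.1 C.2).2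
  set T := ∑ C ∈ D, f C with hT
  rcases le_or_gt T 0 with hT0 | hT0
  · exact ⟨∅, by simp, by simp, by simpa using hT0⟩
  obtain ⟨M, hM⟩ := exists_nat_gt (2 * (D.card : ℝ) / T)
  have hM0 : (0 : ℝ) < M := lt_of_le_of_lt (by positivity) hM
  have hMT : 2 * (D.card : ℝ) ≤ M * T := ((div_lt_iff₀ hT0).1 hM).le
  let w : Finset ε → ℕ := fun C => ⌊(M : ℝ) * f C⌋₊
  have hw1 : ∀ C, (w C : ℝ) ≤ M * f C := fun C => Nat.floor_le (mul_nonneg hM0.le (hf0 C))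
  have hw2 : ∀ C, (M : ℝ) * f C ≤ w C + 1 := fun C => (Nat.lt_floor_add_one _).le
  let ι := Σ C : D, Fin (w C)
  have hcardι : (M : ℝ) * T ≤ 2 * Fintype.card ι := by
    have h1 : (Fintype.card ι : ℝ) = ∑ C ∈ D, (w C : ℝ) := by
      rw [Fintype.card_sigma, Nat.cast_sum, ← Finset.sum_coe_sort D fun C => (w C : ℝ)]
      simp
    have h2 : (M : ℝ) * T ≤ ∑ C ∈ D, ((w C : ℝ) + 1) := by
      rw [hT, Finset.mul_sum]
      exact Finset.sum_le_sum fun C _ => hw2 C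
    rw [Finset.sum_add_distrib, ← h1] at h2
    simp only [Finset.sum_const, nsmul_eq_mul, mul_one] at h2
    linarith
  choose A hAC hA using fun C : D => (hmemD C).exists_cut hends h
  have hcap : ∀ e, (Finset.univ.filter fun i : ι => Crosses l r (A i.1) e).card ≤ M := by
    intro e
    have h1 : (Finset.univ.filter fun i : ι => Crosses l r (A i.1) e) =
        (Finset.univ.filter fun C : D => e ∈ C.1).sigma fun _ => Finset.univ := by
      ext ⟨C, k⟩
      rw [Finset.mem_filter, hAC]
      refine Iff.trans ?_ Finset.mem_sigma.symm
      simp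
    rw [h1, Finset.card_sigma]
    have h2 : ((∑ C ∈ Finset.univ.filter (fun C : D => e ∈ C.1), w C : ℕ) : ℝ) ≤ M := by
      rw [Nat.cast_sum]
      calc ∑ C ∈ Finset.univ.filter (fun C : D => e ∈ C.1), (w C : ℝ)
          = ∑ C ∈ D.filter (fun C => e ∈ C), (w C : ℝ) := by
            rw [Finset.sum_filter, Finset.sum_filter,
              Finset.sum_coe_sort D fun C => if e ∈ C then (w C : ℝ) else 0]
        _ ≤ ∑ C ∈ D.filter (fun C => e ∈ C), (M : ℝ) * f C :=
            Finset.sum_le_sum fun C _ => hw1 C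
        _ = M * ∑ C ∈ D.filter (fun C => e ∈ C), f C := (Finset.mul_sum _ _ _).symm
        _ ≤ M * 1 := by
            refine mul_le_mul_of_nonneg_left ?_ hM0.le
            rw [hD, Finset.filter_filter]
            exact hfcap e
        _ = M := mul_one _
    refine le_trans (le_of_eq ?_) (Nat.cast_le.1 h2)
    exact Finset.sum_congr rfl fun C _ => by simp
  obtain ⟨B, hB, hBdem, hBcap⟩ := exists_laminar l r Dem M (fun i : ι => A i.1)
    (fun i => hA i.1) hcap
  let φ := Fintype.equivFin ι
  obtain ⟨S, hSN, hS⟩ := IsLaminar.exists_subfamily (A := fun k => B (φ.symm k))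
    (fun i j => hB _ _) M (Nat.cast_pos.1 hM0)
  have hcount : ∀ e x y, (x = l e ∧ y = r e ∨ x = r e ∧ y = l e) →
      (Finset.univ.filter fun k => x ∈ B (φ.symm k) ∧ y ∉ B (φ.symm k)).card ≤ M := by
    intro e x y hxy
    refine le_trans (Finset.card_le_card_of_injOn φ.symm ?_ φ.symm.injective.injOn) (hBcap e)
    intro k hk
    have hk := (Finset.mem_filter.1 hk).2
    refine Finset.mem_coe.2 (Finset.mem_filter.2 ⟨Finset.mem_univ _, fun hh => ?_⟩)
    rcases hxy with ⟨rfl, rfl⟩ | ⟨rfl, rfl⟩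
    · exact hk.2 (hh.1 hk.1)
    · exact hk.2 (hh.2 hk.1)
  obtain ⟨B', I, hB', hI, hSI⟩ := exists_disjoint_cuts h Dem (fun i j => hB _ _)
    (fun k => hBdem (φ.symm k)) S (fun e x y hxy => hS x y (hcount e x y hxy))
  choose C hC hCB using fun k => (hB' k).exists_isDCycle hends h
  have hdisj : ∀ i ∈ I, ∀ j ∈ I, i ≠ j → Disjoint (C i) (C j) := fun i hi j hj hij =>
    Finset.disjoint_left.2 fun e hei hej => hI i hi j hj hij e ⟨hCB i e hei, hCB j e hej⟩
  have hinj : Set.InjOn C I := by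
    intro i hi j hj hij
    by_contra hne
    have h1 := hdisj i hi j hj hne
    rw [← hij, disjoint_self] at h1
    have h2 := (hC i).2
    rw [h1] at h2
    simp at h2
  refine ⟨I.image C, ?_, ?_, ?_⟩
  · intro X hX
    obtain ⟨i, -, rfl⟩ := Finset.mem_image.1 hX
    exact hC i
  · intro X hX Y hY hne
    obtain ⟨i, hi, rfl⟩ := Finset.mem_image.1 hX
    obtain ⟨j, hj, rfl⟩ := Finset.mem_image.1 hY
    exact hdisj i hi j hj fun hij => hne (hij ▸ rfl)
  · rw [Finset.card_image_of_injOn hinj]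
    have h1 : (Fintype.card ι : ℝ) ≤ M * S.card := by exact_mod_cast hSN
    have h2 : (S.card : ℝ) ≤ 7 * I.card := by exact_mod_cast hSI
    have h3 : (M : ℝ) * T ≤ M * (14 * I.card) := by nlinarith
    exact le_of_mul_le_mul_left h3 hM0

section Grid

/-- The edge `(p, false)` of the grid goes one step to the right from `p`, the edge `(p, true)`
one step up. -/
def gridHead (g : (ℤ × ℤ) × Bool) : ℤ × ℤ :=
  if g.2 then (g.1.1, g.1.2 + 1) else (g.1.1 + 1, g.1.2)

/-- The face of the grid, other than `g.1`, incident with the edge `g`; the face `p` is the one with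
`p` as its lower left corner. -/
def gridFace (g : (ℤ × ℤ) × Bool) : ℤ × ℤ :=
  if g.2 then (g.1.1 - 1, g.1.2) else (g.1.1, g.1.2 - 1)

def GridAdj (p q : ℤ × ℤ) : Prop :=
  ∃ g : (ℤ × ℤ) × Bool, (g.1 = p ∧ gridHead g = q) ∨ (g.1 = q ∧ gridHead g = p)

theorem GridAdj.symm {p q : ℤ × ℤ} (h : GridAdj p q) : GridAdj q p :=
  h.imp fun _ hg => hg.symm

theorem bd_grid (B : Finset ((ℤ × ℤ) × Bool)) (c : (ℤ × ℤ) × Bool → ZMod 2)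
    (hc : ∀ g, g ∉ B → c g = 0) (i j : ℤ) :
    bd (fun g : B => g.1.1) (fun g : B => gridHead g.1) (fun g => c g.1) (i, j) =
      c ((i, j), false) + c ((i - 1, j), false) + c ((i, j), true) + c ((i, j - 1), true) := by
  have h1 : ∀ g : (ℤ × ℤ) × Bool,
      (if g.1 = (i, j) then c g else 0) + (if gridHead g = (i, j) then c g else 0) =
      (if ((i, j), false) = g then c g else 0) + (if ((i - 1, j), false) = g then c g else 0) +
        (if ((i, j), true) = g then c g else 0) + (if ((i, j - 1), true) = g then c g else 0) := by
    rintro ⟨⟨x, y⟩, t⟩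
    have e1 : (x + 1 = i) ↔ (i - 1 = x) := by omega
    have e2 : (y + 1 = j) ↔ (j - 1 = y) := by omega
    cases t <;> simp [gridHead, e1, e2, eq_comm (a := x) (b := i), eq_comm (a := y) (b := j)]
  have h2 : ∀ g₀, (∑ g ∈ B, if g₀ = g then c g else 0) = c g₀ := by
    intro g₀
    rw [Finset.sum_ite_eq]
    split_ifs with h
    · rfl
    · exact (hc _ h).symm
  have h3 := Finset.sum_coe_sort B fun g =>
    (if g.1 = (i, j) then c g else 0) + (if gridHead g = (i, j) then c g else 0)
  rw [Finset.sum_congr (s₁ := B) rfl fun g _ => h1 g] at h3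
  simp only [Finset.sum_add_distrib, h2] at h3
  rw [← h3, bd, Finset.sum_add_distrib]
  congr!

/-- Every finite subgraph of the grid has an algebraic dual. -/
theorem isDualPair_grid (B : Finset ((ℤ × ℤ) × Bool)) (rel : ℤ × ℤ → ℤ × ℤ → Prop)
    (hrel : ∀ q q', rel q q' ↔ ∃ g ∉ B, gridFace g = q ∧ g.1 = q') :
    IsDualPair (fun g : B => g.1.1) (fun g : B => gridHead g.1)
      (fun g : B => Quot.mk rel (gridFace g.1)) (fun g : B => Quot.mk rel g.1.1) := by
  have hh : ∀ t : ZMod 2, t + t = 0 := CharTwo.add_self_eq_zero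
  intro c'
  obtain ⟨c, hc, rfl⟩ : ∃ c : (ℤ × ℤ) × Bool → ZMod 2, (∀ g, g ∉ B → c g = 0) ∧
      c' = fun g => c g.1 := by
    refine ⟨fun g => if h : g ∈ B then c' ⟨g, h⟩ else 0, fun g hg => dif_neg hg, ?_⟩
    ext g
    simp
  suffices h : (∀ p, bd (fun g : B => g.1.1) (fun g : B => gridHead g.1) (fun g => c g.1) p = 0) ↔
      ∃ s : ℤ × ℤ → ZMod 2, ∀ g, c g = s (gridFace g) + s g.1 by
    rw [h]
    constructor
    · rintro ⟨s, hs⟩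
      refine ⟨Quot.lift s ?_, fun g => hs g.1⟩
      intro q q' hqq
      obtain ⟨g, hg, rfl, rfl⟩ := (hrel q q').1 hqq
      have := hs g
      rw [hc g hg] at this
      exact CharTwo.add_eq_zero.1 this.symm
    · rintro ⟨S, hS⟩
      refine ⟨fun q => S (Quot.mk rel q), fun g => ?_⟩
      by_cases hg : g ∈ B
      · exact hS ⟨g, hg⟩
      · dsimp only
        rw [hc g hg, Quot.sound ((hrel _ _).2 ⟨g, hg, rfl, rfl⟩), hh]
  constructor
  · intro hbd
    have hbd' : ∀ i j, c ((i, j), false) + c ((i - 1, j), false) + c ((i, j), true) +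
        c ((i, j - 1), true) = 0 := fun i j => by rw [← bd_grid B c hc, hbd]
    set J : Finset ℤ := B.image fun g => g.1.2 with hJ
    have hcJ : ∀ i j t, j ∉ J → c ((i, j), t) = 0 := fun i j t hj =>
      hc _ fun hB => hj (Finset.mem_image.2 ⟨_, hB, rfl⟩)
    let s : ℤ × ℤ → ZMod 2 := fun p => ∑ j ∈ J.filter (· ≤ p.2), c ((p.1, j), false)
    have hs1 : ∀ i j, s (i, j) = s (i, j - 1) + c ((i, j), false) := by
      intro i j
      by_cases hj : j ∈ J
      · have : J.filter (· ≤ j) = insert j (J.filter (· ≤ j - 1)) := by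
          ext k
          simp only [Finset.mem_filter, Finset.mem_insert]
          constructor
          · rintro ⟨h1, h2⟩
            rcases h2.eq_or_lt with rfl | h2
            · exact Or.inl rfl
            · exact Or.inr ⟨h1, by omega⟩
          · rintro (rfl | ⟨h1, h2⟩)
            · exact ⟨hj, le_rfl⟩
            · exact ⟨h1, by omega⟩
        simp only [s, this]
        rw [Finset.sum_insert (by simp), add_comm]
      · have : J.filter (· ≤ j) = J.filter (· ≤ j - 1) := by
          refine Finset.filter_congr fun k hk => ?_
          have : k ≠ j := fun h => hj (h ▸ hk)
          omega
        simp only [s, this]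
        rw [hcJ i j _ hj, add_zero]
    have hstep : ∀ i j, c ((i, j), true) + s (i - 1, j) + s (i, j) =
        c ((i, j - 1), true) + s (i - 1, j - 1) + s (i, j - 1) := by
      intro i j
      rw [hs1 i j, hs1 (i - 1) j]
      linear_combination hbd' i j - hh (c ((i, j - 1), true))
    have hconst : ∀ i j, ∀ n : ℕ, c ((i, j), true) + s (i - 1, j) + s (i, j) =
        c ((i, j - n), true) + s (i - 1, j - n) + s (i, j - n) := by
      intro i j n
      induction n with
      | zero => simp
      | succ n ih =>
        rw [ih, hstep]
        push_cast
        rw [show j - (n : ℤ) - 1 = j - (n + 1) by ring]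
    have hs2 : ∀ i j, c ((i, j), true) + s (i - 1, j) + s (i, j) = 0 := by
      intro i j
      obtain ⟨m, hm⟩ := J.bddBelow
      have hlow : ∀ k, k < m → k ∉ J := fun k hk hkJ => not_le.2 hk (hm hkJ)
      have hlt : j - ((j - m).toNat + 1 : ℕ) < m := by
        have := Int.self_le_toNat (j - m)
        push_cast
        omega
      have hs0 : ∀ i, s (i, j - ((j - m).toNat + 1 : ℕ)) = 0 := by
        intro i
        refine Finset.sum_eq_zero fun k hk => ?_
        have hk := Finset.mem_filter.1 hk
        exact absurd hk.1 (hlow k (lt_of_le_of_lt hk.2 hlt))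
      rw [hconst i j ((j - m).toNat + 1), hs0, hs0, hcJ _ _ _ (hlow _ hlt), add_zero, add_zero]
    refine ⟨s, ?_⟩
    rintro ⟨⟨i, j⟩, t⟩
    cases t
    · simp only [gridFace, Bool.false_eq_true, if_false]
      linear_combination hs1 i j - hh (s (i, j)) + hh (c ((i, j), false))
    · simp only [gridFace, if_true]
      linear_combination hs2 i j - hh (s (i, j)) - hh (s (i - 1, j))
  · rintro ⟨s, hs⟩ ⟨i, j⟩
    rw [bd_grid B c hc, hs, hs, hs, hs]
    simp only [gridFace, Bool.false_eq_true, if_false, if_true]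
    linear_combination hh (s (i, j - 1)) + hh (s (i, j)) + hh (s (i - 1, j - 1)) +
      hh (s (i - 1, j))

/-- A minor model in the grid yields an algebraic dual. -/
theorem exists_isDualPair_of_grid_model {V R : Type} [Fintype V] [Fintype R]
    (ends : R → Sym2 V) (u v : R → V) (huv : ∀ e, ends e = s(u e, v e)) (hne : ∀ e, u e ≠ v e)
    (X : V → Finset (ℤ × ℤ)) (hX : ∀ i j p, p ∈ X i → p ∈ X j → i = j)
    (hconn : ∀ i, ∀ x ∈ X i, ∀ y ∈ X i,
      Relation.ReflTransGen (fun p q => p ∈ X i ∧ q ∈ X i ∧ GridAdj p q) x y)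
    (y z : R → ℤ × ℤ) (hy : ∀ e, y e ∈ X (u e)) (hz : ∀ e, z e ∈ X (v e))
    (hadj : ∀ e, GridAdj (y e) (z e)) (hinj : ∀ e f, s(y e, z e) = s(y f, z f) → e = f) :
    ∃ (Q : Type) (a b : R → V) (l r : R → Q),
      (∀ e, ends e = s(a e, b e)) ∧ IsDualPair a b l r := by
  choose ρ hρ using hadj
  have hρ' : ∀ e, s((ρ e).1, gridHead (ρ e)) = s(y e, z e) := by
    intro e
    rcases hρ e with ⟨h1, h2⟩ | ⟨h1, h2⟩
    · rw [h1, h2]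
    · rw [h1, h2, Sym2.eq_swap]
  have hρinj : Function.Injective ρ := fun e f hef => hinj e f (by rw [← hρ', ← hρ', hef])
  have hab : ∀ e, ∃ a b, ends e = s(a, b) ∧ (ρ e).1 ∈ X a ∧ gridHead (ρ e) ∈ X b ∧ a ≠ b := by
    intro e
    rcases hρ e with ⟨h1, h2⟩ | ⟨h1, h2⟩
    · exact ⟨u e, v e, huv e, h1 ▸ hy e, h2 ▸ hz e, hne e⟩
    · exact ⟨v e, u e, (huv e).trans Sym2.eq_swap, h1 ▸ hz e, h2 ▸ hy e, (hne e).symm⟩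
  choose a b hends ha hb hab using hab
  set B : Finset ((ℤ × ℤ) × Bool) := (Finset.univ.biUnion X) ×ˢ Finset.univ with hB
  have hmem : ∀ g i, g.1 ∈ X i → g ∈ B := fun g i hg =>
    Finset.mem_product.2 ⟨Finset.mem_biUnion.2 ⟨i, Finset.mem_univ _, hg⟩, Finset.mem_univ _⟩
  have hdual := isDualPair_grid B _ fun q q' => Iff.rfl
  refine ⟨_, a, b, _, _, hends, hdual.minor X hX (fun e => ⟨ρ e, hmem _ _ (ha e)⟩)
    (fun e f hef => hρinj (congrArg Subtype.val hef)) a b ha hb hab ?_ _ fun q q' => Iff.rfl⟩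
  intro i x hx y hy
  refine exists_chain_of_reachable _ _ (fun g : B => ∃ i, g.1.1 ∈ X i ∧ gridHead g.1 ∈ X i) _ ?_
    (hconn i x hx y hy)
  rintro p q ⟨hp, hq, g, ⟨rfl, rfl⟩ | ⟨rfl, rfl⟩⟩
  · exact ⟨⟨g, hmem g i hp⟩, ⟨i, hp, hq⟩, Or.inl ⟨rfl, rfl⟩⟩
  · exact ⟨⟨g, hmem g i hq⟩, ⟨i, hq, hp⟩, Or.inr ⟨rfl, rfl⟩⟩

end Grid

/-- Only finitely many faces of a dual of a finite graph matter. -/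
theorem IsDualPair.exists_fintype {V R Q : Type} [Fintype R] {a b : R → V} {l r : R → Q}
    (h : IsDualPair a b l r) :
    ∃ (F : Type) (_ : Fintype F) (l' r' : R → F), IsDualPair a b l' r' := by
  let K : Finset Q := Finset.univ.image l ∪ Finset.univ.image r
  have hl : ∀ e, l e ∈ K := fun e => by simp [K]
  have hr : ∀ e, r e ∈ K := fun e => by simp [K]
  refine ⟨K, inferInstance, fun e => ⟨l e, hl e⟩, fun e => ⟨r e, hr e⟩, fun c => ?_⟩
  rw [h c]
  constructor
  · rintro ⟨S, hS⟩
    exact ⟨fun q => S q.1, hS⟩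
  · rintro ⟨S, hS⟩
    refine ⟨fun q => if hq : q ∈ K then S ⟨q, hq⟩ else 0, fun e => ?_⟩
    dsimp only
    rw [hS e, dif_pos (hl e), dif_pos (hr e)]

/-- Adding loops to a graph amounts to adding isolated edges to its dual. -/
theorem exists_isDualPair_of_nonloops {V ε : Type} [Fintype ε] (ends : ε → Sym2 V)
    {Q : Type} {a b : {e // ¬ (ends e).IsDiag} → V} {l r : {e // ¬ (ends e).IsDiag} → Q}
    (hends : ∀ e, ends e.1 = s(a e, b e)) (h : IsDualPair a b l r) :
    ∃ (F : Type) (_ : Fintype F) (a b : ε → V) (l r : ε → F),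
      (∀ e, ends e = s(a e, b e)) ∧ IsDualPair a b l r := by
  have hh : ∀ t : ZMod 2, t + t = 0 := CharTwo.add_self_eq_zero
  have hex : ∀ e, ∃ x y, ends e = s(x, y) ∧
      (∀ he : ¬ (ends e).IsDiag, x = a ⟨e, he⟩ ∧ y = b ⟨e, he⟩) ∧ ((ends e).IsDiag → x = y) := by
    intro e
    by_cases he : (ends e).IsDiag
    · exact ⟨_, _, (Sym2.diag_diagElem he).symm, fun hn => absurd he hn, fun _ => rfl⟩
    · exact ⟨_, _, hends ⟨e, he⟩, fun _ => ⟨rfl, rfl⟩, fun hd => absurd hd he⟩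
  choose a' b' hends' hab hloop using hex
  let l' : ε → Q ⊕ ε × Bool := fun e =>
    if he : ¬ (ends e).IsDiag then Sum.inl (l ⟨e, he⟩) else Sum.inr (e, false)
  let r' : ε → Q ⊕ ε × Bool := fun e =>
    if he : ¬ (ends e).IsDiag then Sum.inl (r ⟨e, he⟩) else Sum.inr (e, true)
  have hdual : IsDualPair a' b' l' r' := by
    intro c
    have hbd : ∀ p, bd a' b' c p = bd a b (fun e => c e.1) p := by
      intro p
      symm
      apply Fintype.sum_of_injective Subtype.val Subtype.val_injective
      · intro e he
        rw [hloop e (by_contra fun hn => he ⟨⟨e, hn⟩, rfl⟩)]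
        exact hh _
      · intro e
        rw [(hab e.1 e.2).1, (hab e.1 e.2).2]
    simp only [hbd]
    rw [h]
    constructor
    · rintro ⟨S, hS⟩
      refine ⟨Sum.elim S fun x => if x.2 then 0 else c x.1, fun e => ?_⟩
      by_cases he : (ends e).IsDiag
      · simp [l', r', he]
      · simpa [l', r', he] using hS ⟨e, he⟩
    · rintro ⟨S, hS⟩
      refine ⟨fun q => S (Sum.inl q), fun e => ?_⟩
      have := hS e.1
      simpa only [l', r', dif_pos e.2] using this
  obtain ⟨F, hF, l'', r'', hdual⟩ := hdual.exists_fintype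
  exact ⟨F, hF, a', b', l'', r'', hends', hdual⟩

section GridCells

/-- The closed grid square of side `h` with index `p` contains `x`. -/
def InCell (h : ℝ) (p : ℤ × ℤ) (x : ℝ × ℝ) : Prop :=
  ((p.1 : ℝ) * h ≤ x.1 ∧ x.1 ≤ (p.1 + 1) * h) ∧ ((p.2 : ℝ) * h ≤ x.2 ∧ x.2 ≤ (p.2 + 1) * h)

/-- The grid squares of side `h` meeting `A`. -/
def gridCells (h : ℝ) (A : Set (ℝ × ℝ)) : Set (ℤ × ℤ) :=
  {p | ∃ x ∈ A, InCell h p x}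

/-- The grid vertices `p` and `q` are joined by a path in `W`. -/
def GridConn (W : Set (ℤ × ℤ)) (p q : ℤ × ℤ) : Prop :=
  Relation.ReflTransGen (fun p q => p ∈ W ∧ q ∈ W ∧ GridAdj p q) p q

theorem GridConn.symm {W : Set (ℤ × ℤ)} {p q : ℤ × ℤ} (h : GridConn W p q) : GridConn W q p :=
  Relation.ReflTransGen.mono
    (fun u v (h : v ∈ W ∧ u ∈ W ∧ GridAdj v u) => ⟨h.2.1, h.1, h.2.2.symm⟩) _ _ h.swap

theorem GridConn.mono {W W' : Set (ℤ × ℤ)} (hW : W ⊆ W') {p q : ℤ × ℤ} (h : GridConn W p q) :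
    GridConn W' p q :=
  Relation.ReflTransGen.mono
    (fun u v (h : u ∈ W ∧ v ∈ W ∧ GridAdj u v) => ⟨hW h.1, hW h.2.1, h.2.2⟩) _ _ h

theorem exists_inCell {h : ℝ} (hh : 0 < h) (x : ℝ × ℝ) : ∃ p, InCell h p x := by
  have key : ∀ t : ℝ, (⌊t / h⌋ : ℝ) * h ≤ t ∧ t ≤ (⌊t / h⌋ + 1) * h := fun t =>
    ⟨(le_div_iff₀ hh).1 (Int.floor_le _), (div_le_iff₀ hh).1 (Int.lt_floor_add_one _).le⟩
  exact ⟨(⌊x.1 / h⌋, ⌊x.2 / h⌋), key _, key _⟩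

theorem isClosed_inCell (h : ℝ) (p : ℤ × ℤ) : IsClosed {x | InCell h p x} :=
  ((isClosed_le continuous_const continuous_fst).inter
    (isClosed_le continuous_fst continuous_const)).inter
  ((isClosed_le continuous_const continuous_snd).inter
    (isClosed_le continuous_snd continuous_const))

theorem eq_or_near {h : ℝ} (hh : 0 < h) {i j : ℤ} {t : ℝ}
    (hi : (i : ℝ) * h ≤ t ∧ t ≤ (i + 1) * h) (hj : (j : ℝ) * h ≤ t ∧ t ≤ (j + 1) * h) :
    i = j ∨ i + 1 = j ∨ j + 1 = i := by
  have h1 : (i : ℝ) ≤ j + 1 := le_of_mul_le_mul_right (hi.1.trans hj.2) hh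
  have h2 : (j : ℝ) ≤ i + 1 := le_of_mul_le_mul_right (hj.1.trans hi.2) hh
  norm_cast at h1 h2
  omega

theorem gridConn_of_inCell {h : ℝ} (hh : 0 < h) {A : Set (ℝ × ℝ)} {x : ℝ × ℝ} (hx : x ∈ A)
    {p q : ℤ × ℤ} (hp : InCell h p x) (hq : InCell h q x) : GridConn (gridCells h A) p q := by
  obtain ⟨p₁, p₂⟩ := p
  obtain ⟨q₁, q₂⟩ := q
  have hm : InCell h (p₁, q₂) x := ⟨hp.1, hq.2⟩
  have h1 : GridConn (gridCells h A) (p₁, p₂) (p₁, q₂) := by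
    rcases eq_or_near hh hp.2 hq.2 with h | h | h <;> dsimp only at h <;> subst h
    · exact .refl
    · exact .single ⟨⟨x, hx, hp⟩, ⟨x, hx, hm⟩, ((p₁, p₂), true), Or.inl ⟨rfl, rfl⟩⟩
    · exact .single ⟨⟨x, hx, hp⟩, ⟨x, hx, hm⟩, ((p₁, q₂), true), Or.inr ⟨rfl, rfl⟩⟩
  have h2 : GridConn (gridCells h A) (p₁, q₂) (q₁, q₂) := by
    rcases eq_or_near hh hp.1 hq.1 with h | h | h <;> dsimp only at h <;> subst h
    · exact .refl
    · exact .single ⟨⟨x, hx, hm⟩, ⟨x, hx, hq⟩, ((p₁, q₂), false), Or.inl ⟨rfl, rfl⟩⟩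
    · exact .single ⟨⟨x, hx, hm⟩, ⟨x, hx, hq⟩, ((q₁, q₂), false), Or.inr ⟨rfl, rfl⟩⟩
  exact h1.trans h2

theorem finite_gridCells {h : ℝ} (hh : 0 < h) {A : Set (ℝ × ℝ)} (hA : Bornology.IsBounded A) :
    (gridCells h A).Finite := by
  obtain ⟨R, hR⟩ := hA.exists_norm_le
  have key : ∀ (i : ℤ) (t : ℝ), |t| ≤ R → (i : ℝ) * h ≤ t → t ≤ (i + 1) * h →
      -⌈R / h⌉ - 1 ≤ i ∧ i ≤ ⌈R / h⌉ := by
    intro i t ht h1 h2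
    have hc := Int.le_ceil (R / h)
    have ht := abs_le.1 ht
    have h3 : (i : ℝ) ≤ R / h := (le_div_iff₀ hh).2 (h1.trans ht.2)
    have h4 : -((i : ℝ) + 1) ≤ R / h := (le_div_iff₀ hh).2 (by linarith)
    constructor
    · have : -((i : ℝ) + 1) ≤ ⌈R / h⌉ := h4.trans hc
      norm_cast at this
      omega
    · exact_mod_cast h3.trans hc
  refine (Set.finite_Icc (-⌈R / h⌉ - 1, -⌈R / h⌉ - 1) (⌈R / h⌉, ⌈R / h⌉)).subset ?_
  rintro ⟨i, j⟩ ⟨x, hx, ⟨h1, h2⟩, h3, h4⟩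
  have hn := hR x hx
  have k1 := key i x.1 ((norm_fst_le x).trans hn) h1 h2
  have k2 := key j x.2 ((norm_snd_le x).trans hn) h3 h4
  exact ⟨⟨k1.1, k2.1⟩, ⟨k1.2, k2.2⟩⟩

/-- The grid squares meeting a bounded connected set form a connected set. -/
theorem gridConn_gridCells {h : ℝ} (hh : 0 < h) {A : Set (ℝ × ℝ)} (hA : Bornology.IsBounded A)
    (hconn : IsPreconnected A) {p q : ℤ × ℤ} (hp : p ∈ gridCells h A) (hq : q ∈ gridCells h A) :
    GridConn (gridCells h A) p q := by
  by_contra hcon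
  set C₁ := {c ∈ gridCells h A | GridConn (gridCells h A) p c} with hC₁
  set C₂ := {c ∈ gridCells h A | ¬ GridConn (gridCells h A) p c} with hC₂
  have hfin := finite_gridCells hh hA
  have hcl : ∀ C ⊆ gridCells h A, IsClosed (⋃ c ∈ C, {x | InCell h c x}) := fun C hC =>
    (hfin.subset hC).isClosed_biUnion fun c _ => isClosed_inCell h c
  have hcover : A ⊆ (⋃ c ∈ C₁, {x | InCell h c x}) ∪ ⋃ c ∈ C₂, {x | InCell h c x} := by
    intro x hx
    obtain ⟨c, hc⟩ := exists_inCell hh x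
    have hcA : c ∈ gridCells h A := ⟨x, hx, hc⟩
    by_cases hr : GridConn (gridCells h A) p c
    · exact Or.inl (Set.mem_biUnion (show c ∈ C₁ from ⟨hcA, hr⟩) hc)
    · exact Or.inr (Set.mem_biUnion (show c ∈ C₂ from ⟨hcA, hr⟩) hc)
  obtain ⟨x, hx, hpx⟩ := hp
  obtain ⟨y, hy, hqy⟩ := hq
  obtain ⟨z, hzA, hz1, hz2⟩ := isPreconnected_closed_iff.1 hconn _ _
    (hcl C₁ (Set.sep_subset _ _)) (hcl C₂ (Set.sep_subset _ _)) hcover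
    ⟨x, hx, Set.mem_biUnion (show p ∈ C₁ from ⟨⟨x, hx, hpx⟩, .refl⟩) hpx⟩
    ⟨y, hy, Set.mem_biUnion (show q ∈ C₂ from ⟨⟨y, hy, hqy⟩, hcon⟩) hqy⟩
  obtain ⟨c₁, hc₁, hzc₁⟩ := Set.mem_iUnion₂.1 hz1
  obtain ⟨c₂, hc₂, hzc₂⟩ := Set.mem_iUnion₂.1 hz2
  exact hc₂.2 (hc₁.2.trans (gridConn_of_inCell hh hzA hzc₁ hzc₂))

theorem exists_dist_le_of_mem_gridCells {h : ℝ} {A B : Set (ℝ × ℝ)} {p : ℤ × ℤ}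
    (hA : p ∈ gridCells h A) (hB : p ∈ gridCells h B) : ∃ x ∈ A, ∃ y ∈ B, dist x y ≤ h := by
  obtain ⟨x, hx, h1, h2⟩ := hA
  obtain ⟨y, hy, h3, h4⟩ := hB
  refine ⟨x, hx, y, hy, ?_⟩
  rw [Prod.dist_eq, max_le_iff, Real.dist_eq, Real.dist_eq, abs_le, abs_le]
  refine ⟨⟨?_, ?_⟩, ?_, ?_⟩ <;> linarith

/-- A path from `x` to a point of `B` contains a first step into `B`. -/
theorem GridConn.exists_first_step {W B : Set (ℤ × ℤ)} {x t : ℤ × ℤ} (h : GridConn W x t)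
    (hx : x ∉ B) (ht : t ∈ B) :
    ∃ y z, GridConn (W \ B) x y ∧ y ∈ W \ B ∧ z ∈ W ∩ B ∧ GridAdj y z := by
  suffices hs : ∀ t, GridConn W x t → (GridConn (W \ B) x t ∧ t ∉ B) ∨
      ∃ y z, GridConn (W \ B) x y ∧ y ∈ W \ B ∧ z ∈ W ∩ B ∧ GridAdj y z by
    rcases hs t h with h | h
    · exact absurd ht h.2
    · exact h
  intro t h
  induction h with
  | refl => exact Or.inl ⟨.refl, hx⟩
  | @tail p q _ hpq ih =>
    rcases ih with ⟨hp, hpB⟩ | ih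
    · by_cases hq : q ∈ B
      · exact Or.inr ⟨p, q, hp, ⟨hpq.1, hpB⟩, ⟨hpq.2.1, hq⟩, hpq.2.2⟩
      · exact Or.inl ⟨hp.tail ⟨⟨hpq.1, hpB⟩, ⟨hpq.2.1, hq⟩, hpq.2.2⟩, hq⟩
    · exact Or.inr ih

theorem eventually_three_mul_lt_dist {K L : Set (ℝ × ℝ)} (hK : IsCompact K) (hL : IsCompact L)
    (hKL : ∀ x ∈ K, ∀ y ∈ L, x ≠ y) :
    ∀ᶠ r in nhdsWithin (0 : ℝ) (Set.Ioi 0), ∀ x ∈ K, ∀ y ∈ L, 3 * r < dist x y := by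
  rcases (K ×ˢ L).eq_empty_or_nonempty with he | hne
  · refine Filter.Eventually.of_forall fun r x hx y hy => ?_
    exact absurd (show (x, y) ∈ K ×ˢ L from ⟨hx, hy⟩) (he ▸ Set.notMem_empty _)
  · obtain ⟨⟨x₀, y₀⟩, ⟨hx₀, hy₀⟩, hmin⟩ :=
      (hK.prod hL).exists_isMinOn hne (continuous_dist (α := ℝ × ℝ)).continuousOn
    have hpos : 0 < dist x₀ y₀ := dist_pos.2 (hKL x₀ hx₀ y₀ hy₀)
    filter_upwards [Ioo_mem_nhdsGT (show (0 : ℝ) < dist x₀ y₀ / 3 by positivity)]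
      with r hr x hx y hy
    have h1 : dist x₀ y₀ ≤ dist x y := hmin (show (x, y) ∈ K ×ˢ L from ⟨hx, hy⟩)
    have h2 := hr.2
    linarith

end GridCells

/-- A drawing of a loopless graph in the plane induces a minor model in a fine grid, hence an
algebraic dual. -/
theorem IsPlanar.exists_isDualPair_of_loopless {V R : Type} [Fintype V] [Fintype R]
    {ends : R → Sym2 V} (hloop : ∀ e, ¬ (ends e).IsDiag) (hplanar : IsPlanar ends) :
    ∃ (Q : Type) (a b : R → V) (l r : R → Q),
      (∀ e, ends e = s(a e, b e)) ∧ IsDualPair a b l r := by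
  obtain ⟨pos, arc, hpos, hcont, hends, -, hdisj, havoid⟩ := hplanar
  have huv : ∀ e, ∃ u v, ends e = s(u, v) ∧ u ≠ v ∧ arc e 0 = pos u ∧ arc e 1 = pos v := by
    intro e
    obtain ⟨⟨x, y⟩, hxy⟩ := Sym2.mk_surjective (ends e)
    have hne : x ≠ y := fun h => hloop e (by rw [← hxy]; exact Sym2.mk_isDiag_iff.2 h)
    rcases hends e x y hxy.symm with h | h
    · exact ⟨x, y, hxy.symm, hne, h⟩
    · exact ⟨y, x, hxy.symm.trans Sym2.eq_swap, hne.symm, h⟩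
  choose u v hends huv h0 h1 using huv
  -- a radius separating vertices from each other and from the edges not incident with them
  obtain ⟨r, ⟨hr1, hr2⟩, hr0⟩ := (((Filter.eventually_all.2 fun i : V => Filter.eventually_all.2
      fun j : V => show ∀ᶠ r in nhdsWithin (0 : ℝ) (Set.Ioi 0),
        i ≠ j → 3 * r < dist (pos i) (pos j) from by
      by_cases hij : i = j
      · exact Filter.Eventually.of_forall fun r hne => absurd hij hne
      · filter_upwards [eventually_three_mul_lt_dist (isCompact_singleton (x := pos i))
          (isCompact_singleton (x := pos j))
          (by rintro x rfl y rfl hxy; exact hij (hpos hxy))] with r hr _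
        exact hr _ rfl _ rfl).and (Filter.eventually_all.2 fun e : R => Filter.eventually_all.2
      fun w : V => show ∀ᶠ r in nhdsWithin (0 : ℝ) (Set.Ioi 0),
        w ≠ u e → w ≠ v e → ∀ t ∈ Set.Icc (0 : ℝ) 1, 3 * r < dist (arc e t) (pos w) from by
      by_cases hw : w ≠ u e ∧ w ≠ v e
      · filter_upwards [eventually_three_mul_lt_dist (isCompact_Icc.image_of_continuousOn (hcont e))
          (isCompact_singleton (x := pos w))
          (by
            rintro _ ⟨t, ht, rfl⟩ _ rfl hxy
            rcases ht.1.eq_or_lt with rfl | ht0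
            · exact hw.1 (hpos (hxy.symm.trans (h0 e)))
            rcases ht.2.eq_or_lt with rfl | ht1
            · exact hw.2 (hpos (hxy.symm.trans (h1 e)))
            exact havoid e t ⟨ht0, ht1⟩ w hxy)] with r hr _ _ t ht
        exact hr _ ⟨t, ht, rfl⟩ _ rfl
      · exact Filter.Eventually.of_forall fun r h h' => absurd ⟨h, h'⟩ hw)).and
      self_mem_nhdsWithin).exists
  replace hr0 : 0 < r := hr0
  -- the middle part of each edge
  have hs : ∀ e, ∃ s, 0 < s ∧ s < 1 / 2 ∧ dist (arc e s) (pos (u e)) < r ∧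
      dist (arc e (1 - s)) (pos (v e)) < r := by
    intro e
    obtain ⟨δ, hδ, hδ'⟩ := Metric.continuousWithinAt_iff.1
      (hcont e 0 (Set.left_mem_Icc.2 zero_le_one)) r hr0
    obtain ⟨η, hη, hη'⟩ := Metric.continuousWithinAt_iff.1
      (hcont e 1 (Set.right_mem_Icc.2 zero_le_one)) r hr0
    have hpos : 0 < min (min (δ / 2) (η / 2)) (1 / 4) := by positivity
    have hle1 : min (min (δ / 2) (η / 2)) (1 / 4) ≤ δ / 2 :=
      (min_le_left _ _).trans (min_le_left _ _)
    have hle2 : min (min (δ / 2) (η / 2)) (1 / 4) ≤ η / 2 :=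
      (min_le_left _ _).trans (min_le_right _ _)
    have hle3 : min (min (δ / 2) (η / 2)) (1 / 4) ≤ 1 / 4 := min_le_right _ _
    set s := min (min (δ / 2) (η / 2)) (1 / 4)
    refine ⟨s, hpos, by linarith, ?_, ?_⟩
    · rw [← h0]
      refine hδ' ⟨hpos.le, by linarith⟩ ?_
      rw [Real.dist_eq, sub_zero, abs_of_pos hpos]
      linarith
    · rw [← h1]
      refine hη' ⟨by linarith, by linarith⟩ ?_
      rw [Real.dist_eq, sub_sub_cancel_left, abs_neg, abs_of_pos hpos]
      linarith
  choose s hs0 hs1 hsu hsv using hs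
  let M : R → Set (ℝ × ℝ) := fun e => arc e '' Set.Icc (s e) (1 - s e)
  have hIcc : ∀ e, Set.Icc (s e) (1 - s e) ⊆ Set.Icc 0 1 := fun e =>
    Set.Icc_subset_Icc (hs0 e).le (by linarith [hs0 e])
  have hMcomp : ∀ e, IsCompact (M e) := fun e =>
    isCompact_Icc.image_of_continuousOn ((hcont e).mono (hIcc e))
  have hMconn : ∀ e, IsPreconnected (M e) := fun e =>
    isPreconnected_Icc.image _ ((hcont e).mono (hIcc e))
  -- a grid size separating the middle parts of the edges
  obtain ⟨h, ⟨hM, hhr⟩, hh0⟩ := (((Filter.eventually_all.2 fun e : R => Filter.eventually_all.2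
      fun f : R => show ∀ᶠ h in nhdsWithin (0 : ℝ) (Set.Ioi 0),
        e ≠ f → ∀ x ∈ M e, ∀ y ∈ M f, 3 * h < dist x y from by
      by_cases hef : e = f
      · exact Filter.Eventually.of_forall fun r hne => absurd hef hne
      · filter_upwards [eventually_three_mul_lt_dist (hMcomp e) (hMcomp f) (by
          rintro _ ⟨t, ht, rfl⟩ _ ⟨t', ht', rfl⟩
          exact hdisj e f hef t ⟨(hs0 e).trans_le ht.1, ht.2.trans_lt (by linarith [hs0 e])⟩ t'
            (hIcc f ht'))] with r hr _
        exact hr).and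
      (Ioo_mem_nhdsGT hr0)).and self_mem_nhdsWithin).exists
  replace hh0 : 0 < h := hh0
  replace hhr : h < r := hhr.2
  let B : V → Set (ℤ × ℤ) := fun w => gridCells h (Metric.closedBall (pos w) r)
  let S : R → Set (ℤ × ℤ) := fun e => gridCells h (M e)
  have hSS : ∀ e f p, p ∈ S e → p ∈ S f → e = f := by
    intro e f p hp hq
    by_contra hne
    obtain ⟨x, hx, y, hy, hxy⟩ := exists_dist_le_of_mem_gridCells hp hq
    linarith [hM e f hne x hx y hy]
  have hBB : ∀ i j p, p ∈ B i → p ∈ B j → i = j := by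
    intro i j p hp hq
    by_contra hne
    obtain ⟨x, hx, y, hy, hxy⟩ := exists_dist_le_of_mem_gridCells hp hq
    have := dist_triangle4 (pos i) x y (pos j)
    rw [Metric.mem_closedBall] at hx hy
    rw [dist_comm] at hx
    linarith [hr1 i j hne]
  have hBS : ∀ i e p, p ∈ B i → p ∈ S e → i = u e ∨ i = v e := by
    intro i e p hp hq
    by_contra hne
    push Not at hne
    obtain ⟨x, hx, y, ⟨t, ht, rfl⟩, hxy⟩ := exists_dist_le_of_mem_gridCells hp hq
    have := dist_triangle (arc e t) x (pos i)
    rw [Metric.mem_closedBall] at hx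
    rw [dist_comm] at hxy
    linarith [hr2 e i hne.1 hne.2 t (hIcc e ht)]
  have hBfin : ∀ i, (B i).Finite := fun i => finite_gridCells hh0 Metric.isBounded_closedBall
  have hBconn : ∀ i, ∀ p ∈ B i, ∀ q ∈ B i, GridConn (B i) p q := fun i p hp q hq =>
    gridConn_gridCells hh0 Metric.isBounded_closedBall
      (convex_closedBall (pos i) r).isPreconnected hp hq
  have hx : ∀ e, ∃ x, x ∈ S e ∧ x ∈ B (u e) := by
    intro e
    obtain ⟨p, hp⟩ := exists_inCell hh0 (arc e (s e))
    exact ⟨p, ⟨_, ⟨s e, Set.left_mem_Icc.2 (by linarith [hs1 e]), rfl⟩, hp⟩,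
      ⟨_, Metric.mem_closedBall.2 (hsu e).le, hp⟩⟩
  have ht : ∀ e, ∃ x, x ∈ S e ∧ x ∈ B (v e) := by
    intro e
    obtain ⟨p, hp⟩ := exists_inCell hh0 (arc e (1 - s e))
    exact ⟨p, ⟨_, ⟨1 - s e, Set.right_mem_Icc.2 (by linarith [hs1 e]), rfl⟩, hp⟩,
      ⟨_, Metric.mem_closedBall.2 (hsv e).le, hp⟩⟩
  choose x hxS hxB using hx
  choose t htS htB using ht
  have hxB' : ∀ e, x e ∉ B (v e) := fun e hxe => huv e (hBB _ _ _ (hxB e) hxe)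
  choose y z hxy hyS hzS hadj using fun e =>
    (gridConn_gridCells hh0 (hMcomp e).isBounded (hMconn e) (hxS e) (htS e)).exists_first_step
      (hxB' e) (htB e)
  let Y : R → Set (ℤ × ℤ) := fun e => {q ∈ S e \ B (v e) | GridConn (S e \ B (v e)) (x e) q}
  have hYconn : ∀ e, ∀ q ∈ Y e, GridConn (Y e) (x e) q := by
    rintro e q ⟨-, hq⟩
    induction hq with
    | refl => exact .refl
    | @tail p q hp hpq ih => exact ih.tail ⟨⟨hpq.1, hp⟩, ⟨hpq.2.1, hp.tail hpq⟩, hpq.2.2⟩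
  let W : V → Set (ℤ × ℤ) := fun i => B i ∪ ⋃ e ∈ {e | u e = i}, Y e
  have hYW : ∀ e, Y e ⊆ W (u e) := fun e q hq =>
    Or.inr (Set.mem_biUnion (show e ∈ {f | u f = u e} from rfl) hq)
  have hWfin : ∀ i, (W i).Finite := fun i => (hBfin i).union
    ((Set.toFinite _).biUnion fun e _ => (finite_gridCells hh0 (hMcomp e).isBounded).subset
      fun q hq => hq.1.1)
  have hWconn : ∀ i, ∀ p ∈ W i, ∀ q ∈ W i, GridConn (W i) p q := by
    intro i
    obtain ⟨c, hc⟩ : ∃ c, c ∈ B i := by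
      obtain ⟨p, hp⟩ := exists_inCell hh0 (pos i)
      exact ⟨p, pos i, Metric.mem_closedBall_self hr0.le, hp⟩
    suffices hs : ∀ p ∈ W i, GridConn (W i) c p from fun p hp q hq => (hs p hp).symm.trans (hs q hq)
    rintro p (hp | hp)
    · exact (hBconn i c hc p hp).mono Set.subset_union_left
    · obtain ⟨e, he, hpe⟩ := Set.mem_iUnion₂.1 hp
      obtain rfl : u e = i := he
      exact ((hBconn _ c hc _ (hxB e)).mono Set.subset_union_left).trans
        ((hYconn e p hpe).mono (hYW e))
  have hWdisj : ∀ i j p, p ∈ W i → p ∈ W j → i = j := by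
    have key : ∀ i e p, p ∈ B i → p ∈ Y e → i = u e := fun i e p hp hq =>
      (hBS i e p hp hq.1.1).resolve_right fun hi => hq.1.2 (hi ▸ hp)
    rintro i j p (hp | hp) (hq | hq)
    · exact hBB i j p hp hq
    · obtain ⟨e, rfl, hqe⟩ := Set.mem_iUnion₂.1 hq
      exact key _ _ _ hp hqe
    · obtain ⟨e, rfl, hpe⟩ := Set.mem_iUnion₂.1 hp
      exact (key _ _ _ hq hpe).symm
    · obtain ⟨e, rfl, hpe⟩ := Set.mem_iUnion₂.1 hp
      obtain ⟨f, rfl, hqf⟩ := Set.mem_iUnion₂.1 hq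
      rw [hSS e f p hpe.1.1 hqf.1.1]
  refine exists_isDualPair_of_grid_model ends u v hends huv (fun i => (hWfin i).toFinset)
    (fun i j p hp hq => hWdisj i j p ((hWfin i).mem_toFinset.1 hp) ((hWfin j).mem_toFinset.1 hq))
    ?_ y z (fun e => (hWfin _).mem_toFinset.2 (hYW e ⟨hyS e, hxy e⟩))
    (fun e => (hWfin _).mem_toFinset.2 (Or.inl (hzS e).2)) hadj ?_
  · intro i p hp q hq
    simp only [Set.Finite.mem_toFinset] at hp hq ⊢
    exact hWconn i p hp q hq
  · intro e f hef
    rcases Sym2.eq_iff.1 hef with ⟨h, -⟩ | ⟨h, -⟩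
    · exact hSS e f (y e) (hyS e).1 (h ▸ (hyS f).1)
    · exact hSS e f (y e) (hyS e).1 (h ▸ (hzS f).1)

/-- Every planar graph has an algebraic dual. -/
theorem IsPlanar.exists_isDualPair {V ε : Type} [Fintype V] [Fintype ε] {ends : ε → Sym2 V}
    (hplanar : IsPlanar ends) :
    ∃ (F : Type) (_ : Fintype F) (a b : ε → V) (l r : ε → F),
      (∀ e, ends e = s(a e, b e)) ∧ IsDualPair a b l r := by
  obtain ⟨pos, arc, hpos, hcont, harc, hinj, hdisj, havoid⟩ := hplanar
  obtain ⟨Q, a, b, l, r, hends, h⟩ := IsPlanar.exists_isDualPair_of_loopless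
    (ends := fun e : {e // ¬ (ends e).IsDiag} => ends e.1) (fun e => e.2)
    ⟨pos, fun e => arc e.1, hpos, fun e => hcont e.1, fun e => harc e.1, fun e => hinj e.1,
      fun e f hef => hdisj e.1 f.1 fun hh => hef (Subtype.ext hh), fun e => havoid e.1⟩
  exact exists_isDualPair_of_nonloops ends hends h

/-- if `G+H` is planar and connected, the value of any feasible solution of
the `D`-cycle packing LP is at most `32` times the cardinality of some family of pairwise
edge-disjoint `D`-cycles (hence at most 32 times the maximum such cardinality). -/
theorem stmt0 {V ε : Type} [Fintype V] [DecidableEq V] [Fintype ε] [DecidableEq ε]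
    (ends : ε → Sym2 V) (Dem : Finset ε)
    (hplanar : IsPlanar ends) (hconn : MGConnected ends)
    (f : Finset ε → ℝ)
    (hf0 : ∀ C : Finset ε, 0 ≤ f C)
    (hfcap : ∀ e : ε,
      ∑ C ∈ Finset.univ.filter (fun C : Finset ε => IsDCycle ends Dem C ∧ e ∈ C), f C ≤ 1) :
    ∃ 𝓕 : Finset (Finset ε),
      (∀ C ∈ 𝓕, IsDCycle ends Dem C) ∧
      (∀ C₁ ∈ 𝓕, ∀ C₂ ∈ 𝓕, C₁ ≠ C₂ → Disjoint C₁ C₂) ∧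
      ∑ C ∈ Finset.univ.filter (fun C : Finset ε => IsDCycle ends Dem C), f C
        ≤ 32 * (𝓕.card : ℝ) := by
  obtain rfl : ‹DecidableEq V› = fun x y => Classical.propDecidable (x = y) :=
    Subsingleton.elim _ _
  obtain rfl : ‹DecidableEq ε› = fun x y => Classical.propDecidable (x = y) :=
    Subsingleton.elim _ _
  obtain ⟨F, hF, a, b, l, r, hends, h⟩ := hplanar.exists_isDualPair
  obtain ⟨𝓕, hcycle, hdisj, hle⟩ := h.exists_packing hends Dem f hf0 hfcap
  refine ⟨𝓕, hcycle, hdisj, hle.trans ?_⟩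
  gcongr
  norm_num

end
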